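/- arXiv:2404.14226 — 2 statements merged into one kernel-verified Lean document; each statement's English description precedes it below -/
import Mathlib

section
/- Let k ≥ 2 be an integer. There exists a constant C > 0, depending only on k, with the following property: for every function q : T̂ → ℝ such that the restriction of q to each open Clough–Tocher subtriangle K̂ᵢ (i = 1,2,3) agrees with a polynomial of total degree ≤ k−1 and such that ∫_{T̂} q = 0, there exists a continuous function v from the closure of T̂ to ℝ² such that v = 0 on the boundary of T̂, the restriction of each component of v to each closed subtriangle K̂ᵢ agrees with a polynomial of total degree ≤ k, div v = q on each open subtriangle K̂ᵢ (where div v := ∂v₁/∂x₁ + ∂v₂/∂x₂, computed on each open subtriangle), and ∫_{T̂}(‖v‖² + ‖Dv‖²) ≤ C² ∫_{T̂} q². -/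
open Set MeasureTheory Function

noncomputable section

/-- The open reference triangle with vertices (0,0), (1,0), (0,1). -/
def Tref : Set (ℝ × ℝ) := {x | 0 < x.1 ∧ 0 < x.2 ∧ x.1 + x.2 < 1}

/-- The three vertices of the reference triangle. -/
def vtx : Fin 3 → ℝ × ℝ := ![(0, 0), (1, 0), (0, 1)]

/-- The (open) Clough–Tocher subtriangles, obtained by connecting the barycenter
to the vertices. -/
def ctK (i : Fin 3) : Set (ℝ × ℝ) :=
  interior (convexHull ℝ {vtx i, vtx (i + 1), ((1 : ℝ) / 3, (1 : ℝ) / 3)})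

/-- A map `ℝ² → ℝ²` whose two components are polynomials of total degree ≤ k. -/
def IsPolyMap (k : ℕ) (F : ℝ × ℝ → ℝ × ℝ) : Prop :=
  ∃ P Q : MvPolynomial (Fin 2) ℝ, P.totalDegree ≤ k ∧ Q.totalDegree ≤ k ∧
    ∀ x : ℝ × ℝ,
      F x = (MvPolynomial.eval ![x.1, x.2] P, MvPolynomial.eval ![x.1, x.2] Q)

/-- The Jacobian determinant of `F`. -/
def jacDet (F : ℝ × ℝ → ℝ × ℝ) (x : ℝ × ℝ) : ℝ :=
  LinearMap.det ((fderiv ℝ F x) : (ℝ × ℝ) →ₗ[ℝ] (ℝ × ℝ))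

/-- The Piola matrix `A(x) = DF(x) / det DF(x)`. -/
def Amap (F : ℝ × ℝ → ℝ × ℝ) (x : ℝ × ℝ) : (ℝ × ℝ) →L[ℝ] (ℝ × ℝ) :=
  (jacDet F x)⁻¹ • fderiv ℝ F x

/-- `B(x) = det DF(x) · (DF(x))⁻¹`, the adjugate of `DF`. -/
def Bmap (F : ℝ × ℝ → ℝ × ℝ) (x : ℝ × ℝ) : (ℝ × ℝ) →L[ℝ] (ℝ × ℝ) :=
  jacDet F x • Ring.inverse (fderiv ℝ F x)

/-- `v` is the Piola transform of `v̂` under `F`. -/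
def IsPiola (F vh v : ℝ × ℝ → ℝ × ℝ) : Prop :=
  ∀ x ∈ closure Tref, v (F x) = Amap F x (vh x)

/-- The `W^{m,p}` seminorm over a set `S` (for `p < ∞`). -/
def semiLp {E : Type*} [NormedAddCommGroup E] [NormedSpace ℝ E]
    (m : ℕ) (p : ℝ) (w : ℝ × ℝ → E) (S : Set (ℝ × ℝ)) : ℝ :=
  (∫ x in S, ‖iteratedFDeriv ℝ m w x‖ ^ p) ^ (1 / p)

/-- The `W^{m,p}` norm over a set `S`: the sum of the seminorms up to order `m`. -/
def normWmp {E : Type*} [NormedAddCommGroup E] [NormedSpace ℝ E]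
    (m : ℕ) (p : ℝ) (w : ℝ × ℝ → E) (S : Set (ℝ × ℝ)) : ℝ :=
  ∑ j ∈ Finset.range (m + 1), semiLp j p w S

/-- The isoparametric bounds of order `k` with constants `CF, c₁, c₂` and parameter `h`. -/
def IsoparamBounds (k : ℕ) (CF c₁ c₂ h : ℝ) (F : ℝ × ℝ → ℝ × ℝ) : Prop :=
  InjOn F (closure Tref) ∧
  (∀ m : ℕ, m ≤ k → ∀ x ∈ Tref, ‖iteratedFDeriv ℝ m F x‖ ≤ CF * h ^ m) ∧
  (∀ m : ℕ, m ≤ k + 1 → ∀ y ∈ F '' Tref,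
    ‖iteratedFDeriv ℝ m (invFunOn F (closure Tref)) y‖ ≤ CF * h ^ (-(m : ℤ))) ∧
  (∀ x ∈ closure Tref, c₁ * h ^ 2 ≤ jacDet F x ∧ jacDet F x ≤ c₂ * h ^ 2)

/-- The (planar) divergence of a vector field. -/
def pdiv (w : ℝ × ℝ → ℝ × ℝ) (x : ℝ × ℝ) : ℝ :=
  (fderiv ℝ w x (1, 0)).1 + (fderiv ℝ w x (0, 1)).2


/-! ## Algebraic part -/

open MvPolynomial in
/-- Barycentric coordinates on the subtriangles: `al i` for vertex `i`. -/
def al : Fin 3 → MvPolynomial (Fin 2) ℝ :=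
  ![C 1 - X 0 - C 2 * X 1, C 2 * X 0 + X 1 - C 1, X 1 - X 0]

open MvPolynomial in
/-- Barycentric coordinates on the subtriangles: `be i` for vertex `i + 1`. -/
def be : Fin 3 → MvPolynomial (Fin 2) ℝ :=
  ![X 0 - X 1, X 0 + C 2 * X 1 - C 1, C 1 - C 2 * X 0 - X 1]

open MvPolynomial in
/-- Barycentric coordinates on the subtriangles: `mu i` for the barycenter. -/
def mu : Fin 3 → MvPolynomial (Fin 2) ℝ :=
  ![C 3 * X 1, C 3 - C 3 * X 0 - C 3 * X 1, C 3 * X 0]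

namespace CT

open MvPolynomial

abbrev R := MvPolynomial (Fin 2) ℝ

lemma deg_add {p q : R} {r : ℕ} (hp : p.totalDegree ≤ r) (hq : q.totalDegree ≤ r) :
    (p + q).totalDegree ≤ r := (totalDegree_add _ _).trans (max_le hp hq)

lemma deg_sub {p q : R} {r : ℕ} (hp : p.totalDegree ≤ r) (hq : q.totalDegree ≤ r) :
    (p - q).totalDegree ≤ r := (totalDegree_sub _ _).trans (max_le hp hq)

lemma deg_mul {p q : R} {a b r : ℕ} (hp : p.totalDegree ≤ a) (hq : q.totalDegree ≤ b)
    (h : a + b ≤ r) : (p * q).totalDegree ≤ r :=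
  (totalDegree_mul _ _).trans ((add_le_add hp hq).trans h)

lemma deg_C {c : ℝ} {r : ℕ} : (C c : R).totalDegree ≤ r := by simp

lemma deg_Cmul {c : ℝ} {p : R} {r : ℕ} (hp : p.totalDegree ≤ r) :
    (C c * p).totalDegree ≤ r := deg_mul (a := 0) deg_C hp (by omega)

lemma deg_X {i : Fin 2} {r : ℕ} (h : 1 ≤ r) : (X i : R).totalDegree ≤ r := by simpa using h

lemma deg_pow {p : R} (hp : p.totalDegree ≤ 1) {n r : ℕ} (h : n ≤ r) :
    (p ^ n).totalDegree ≤ r :=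
  (totalDegree_pow _ _).trans ((Nat.mul_le_mul_left n hp).trans (by omega))

lemma deg_al (i : Fin 3) : (al i).totalDegree ≤ 1 := by
  fin_cases i
  · change (C 1 - X 0 - C 2 * X 1 : R).totalDegree ≤ 1
    exact deg_sub (deg_sub deg_C (deg_X le_rfl)) (deg_Cmul (deg_X le_rfl))
  · change (C 2 * X 0 + X 1 - C 1 : R).totalDegree ≤ 1
    exact deg_sub (deg_add (deg_Cmul (deg_X le_rfl)) (deg_X le_rfl)) deg_C
  · change (X 1 - X 0 : R).totalDegree ≤ 1
    exact deg_sub (deg_X le_rfl) (deg_X le_rfl)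

lemma deg_be (i : Fin 3) : (be i).totalDegree ≤ 1 := by
  fin_cases i
  · change (X 0 - X 1 : R).totalDegree ≤ 1
    exact deg_sub (deg_X le_rfl) (deg_X le_rfl)
  · change (X 0 + C 2 * X 1 - C 1 : R).totalDegree ≤ 1
    exact deg_sub (deg_add (deg_X le_rfl) (deg_Cmul (deg_X le_rfl))) deg_C
  · change (C 1 - C 2 * X 0 - X 1 : R).totalDegree ≤ 1
    exact deg_sub (deg_sub deg_C (deg_Cmul (deg_X le_rfl))) (deg_X le_rfl)

lemma deg_mu (i : Fin 3) : (mu i).totalDegree ≤ 1 := by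
  fin_cases i
  · change (C 3 * X 1 : R).totalDegree ≤ 1
    exact deg_Cmul (deg_X le_rfl)
  · change (C 3 - C 3 * X 0 - C 3 * X 1 : R).totalDegree ≤ 1
    exact deg_sub (deg_sub deg_C (deg_Cmul (deg_X le_rfl))) (deg_Cmul (deg_X le_rfl))
  · change (C 3 * X 0 : R).totalDegree ≤ 1
    exact deg_Cmul (deg_X le_rfl)

/-- Splitting off one degree. -/
lemma split_deg {r : ℕ} (p : R) (hp : p.totalDegree ≤ r + 1) :
    ∃ (c : ℝ) (p1 p2 : R), p1.totalDegree ≤ r ∧ p2.totalDegree ≤ r ∧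
      p = C c + X 0 * p1 + X 1 * p2 := by
  have key : ∀ m ∈ p.support, ∃ (c : ℝ) (p1 p2 : R), p1.totalDegree ≤ r ∧ p2.totalDegree ≤ r ∧
      monomial m (coeff m p) = C c + X 0 * p1 + X 1 * p2 := by
    intro m hm
    have hd : m.sum (fun _ e => e) ≤ r + 1 := (le_totalDegree hm).trans hp
    rw [Finsupp.sum_fintype _ _ (by simp), Fin.sum_univ_two] at hd
    by_cases h0 : m 0 = 0
    · by_cases h1 : m 1 = 0
      · refine ⟨coeff m p, 0, 0, by simp, by simp, ?_⟩
        have : m = 0 := by ext i; fin_cases i <;> simp [h0, h1]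
        subst this; simp
      · refine ⟨0, 0, monomial (m - Finsupp.single 1 1) (coeff m p), by simp, ?_, ?_⟩
        · refine (totalDegree_monomial_le _ _).trans ?_
          rw [Finsupp.sum_fintype _ _ (by simp), Fin.sum_univ_two]
          simp; omega
        · have : m = Finsupp.single 1 1 + (m - Finsupp.single 1 1) := by
            ext i; fin_cases i <;> simp; omega
          simp only [map_zero, mul_zero, zero_add, X, monomial_mul, one_mul]
          rw [← this]
    · refine ⟨0, monomial (m - Finsupp.single 0 1) (coeff m p), 0, ?_, by simp, ?_⟩
      · refine (totalDegree_monomial_le _ _).trans ?_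
        rw [Finsupp.sum_fintype _ _ (by simp), Fin.sum_univ_two]
        simp; omega
      · have : m = Finsupp.single 0 1 + (m - Finsupp.single 0 1) := by
          ext i; fin_cases i <;> simp; omega
        simp only [map_zero, mul_zero, zero_add, add_zero, X, monomial_mul, one_mul]
        rw [← this]
  rw [p.as_sum]
  refine Finset.sum_induction _ (fun p : R => ∃ (c : ℝ) (p1 p2 : R),
    p1.totalDegree ≤ r ∧ p2.totalDegree ≤ r ∧ p = C c + X 0 * p1 + X 1 * p2) ?_ ?_ key
  · rintro _ _ ⟨c, p1, p2, h1, h2, rfl⟩ ⟨c', p1', p2', h1', h2', rfl⟩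
    exact ⟨c + c', p1 + p1', p2 + p2', deg_add h1 h1', deg_add h2 h2', by rw [C_add]; ring⟩
  · exact ⟨0, 0, 0, by simp, by simp, by simp⟩

lemma deg_pderiv {r : ℕ} (p : R) (hp : p.totalDegree ≤ r + 1) (i : Fin 2) :
    (pderiv i p).totalDegree ≤ r := by
  induction r generalizing p with
  | zero =>
    obtain ⟨c, p1, p2, h1, h2, rfl⟩ := split_deg p hp
    rw [totalDegree_eq_zero_iff_eq_C.mp (Nat.le_zero.mp h1),
      totalDegree_eq_zero_iff_eq_C.mp (Nat.le_zero.mp h2)]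
    fin_cases i <;> simp
  | succ r ih =>
    obtain ⟨c, p1, p2, h1, h2, rfl⟩ := split_deg p hp
    have e1 := ih p1 h1
    have e2 := ih p2 h2
    simp only [map_add, pderiv_C, pderiv_mul, zero_add]
    refine deg_add (deg_add ?_ ?_) (deg_add ?_ ?_)
    · fin_cases i <;> simp [h1]
    · exact deg_mul (deg_X le_rfl) e1 (by omega)
    · fin_cases i <;> simp [h2]
    · exact deg_mul (deg_X le_rfl) e2 (by omega)

lemma bary (i : Fin 3) : ∃ a b c a' b' c' : ℝ,
    al i + be i + mu i = 1 ∧ (X 0 : R) = C a * al i + C b * be i + C c * mu i ∧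
    (X 1 : R) = C a' * al i + C b' * be i + C c' * mu i := by
  fin_cases i
  · refine ⟨0, 1, 1/3, 0, 0, 1/3, ?_, ?_, ?_⟩ <;>
    · apply MvPolynomial.funext; intro x; simp [al, be, mu]; try ring
  · refine ⟨1, 0, 1/3, 0, 1, 1/3, ?_, ?_, ?_⟩ <;>
    · apply MvPolynomial.funext; intro x; simp [al, be, mu]; try ring
  · refine ⟨0, 0, 1/3, 1, 0, 1/3, ?_, ?_, ?_⟩ <;>
    · apply MvPolynomial.funext; intro x; simp [al, be, mu]; try ring

lemma split_bary {r : ℕ} (i : Fin 3) (p : R) (hp : p.totalDegree ≤ r + 1) :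
    ∃ p1 p2 p3 : R, p1.totalDegree ≤ r ∧ p2.totalDegree ≤ r ∧ p3.totalDegree ≤ r ∧
      p = al i * p1 + be i * p2 + mu i * p3 := by
  obtain ⟨d, p1, p2, h1, h2, hp⟩ := split_deg p hp
  obtain ⟨a, b, c, a', b', c', e1, e2, e3⟩ := bary i
  refine ⟨C d + C a * p1 + C a' * p2, C d + C b * p1 + C b' * p2, C d + C c * p1 + C c' * p2,
    deg_add (deg_add deg_C (deg_Cmul h1)) (deg_Cmul h2),
    deg_add (deg_add deg_C (deg_Cmul h1)) (deg_Cmul h2),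
    deg_add (deg_add deg_C (deg_Cmul h1)) (deg_Cmul h2), ?_⟩
  rw [hp]
  linear_combination p1 * e2 + p2 * e3 - C d * e1

/-- Edge decomposition. -/
lemma edge_decomp (r : ℕ) (i : Fin 3) (p : R) (hp : p.totalDegree ≤ r + 1) :
    ∃ (c d : ℝ) (t g : R), (al i * be i * t).totalDegree ≤ r + 1 ∧ g.totalDegree ≤ r ∧
      p = C c * al i ^ (r + 1) + C d * be i ^ (r + 1) + al i * be i * t + mu i * g := by
  suffices h : ∃ (c d : ℝ) (t g : R), (t.totalDegree + 2 ≤ r + 1 ∨ t = 0) ∧ g.totalDegree ≤ r ∧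
      p = C c * al i ^ (r + 1) + C d * be i ^ (r + 1) + al i * be i * t + mu i * g by
    obtain ⟨c, d, t, g, ht, hg, h⟩ := h
    refine ⟨c, d, t, g, ?_, hg, h⟩
    rcases ht with ht | rfl
    · exact deg_mul (a := 2) (deg_mul (deg_al i) (deg_be i) le_rfl) le_rfl (by omega)
    · simp
  induction r generalizing p with
  | zero =>
    obtain ⟨p1, p2, p3, h1, h2, h3, e⟩ := split_bary i p hp
    rw [totalDegree_eq_zero_iff_eq_C.mp (Nat.le_zero.mp h1),
      totalDegree_eq_zero_iff_eq_C.mp (Nat.le_zero.mp h2)] at e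
    exact ⟨coeff 0 p1, coeff 0 p2, 0, p3, Or.inr rfl, h3, by rw [e]; ring⟩
  | succ r ih =>
    obtain ⟨p1, p2, p3, h1, h2, h3, e⟩ := split_bary i p hp
    obtain ⟨c, d, t, g, ht, hg, e1⟩ := ih p1 h1
    obtain ⟨c', d', t', g', ht', hg', e2⟩ := ih p2 h2
    refine ⟨c, d', C d * be i ^ r + al i * t + (C c' * al i ^ r + be i * t'),
      al i * g + be i * g' + p3, Or.inl ?_, ?_, ?_⟩
    · have : (C d * be i ^ r + al i * t + (C c' * al i ^ r + be i * t')).totalDegree ≤ r := by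
        refine deg_add (deg_add (deg_Cmul (deg_pow (deg_be i) le_rfl)) ?_)
          (deg_add (deg_Cmul (deg_pow (deg_al i) le_rfl)) ?_)
        · rcases ht with ht | rfl
          · exact deg_mul (deg_al i) le_rfl (by omega)
          · simp
        · rcases ht' with ht | rfl
          · exact deg_mul (deg_be i) le_rfl (by omega)
          · simp
      omega
    · exact deg_add (deg_add (deg_mul (deg_al i) hg (by omega)) (deg_mul (deg_be i) hg' (by omega)))
        h3
    · rw [e, e1, e2]; ring

/-- Continuity across the interior edges. -/
def Compat (F : Fin 3 → R) : Prop :=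
  ∀ i x, eval x (al i) = 0 → eval x (F i) = eval x (F (i + 1))

def Bd (F : Fin 3 → R) : Prop := ∀ i x, eval x (mu i) = 0 → eval x (F i) = 0

structure Adm (k : ℕ) (F : Fin 3 → R) : Prop where
  deg : ∀ i, (F i).totalDegree ≤ k
  compat : Compat F
  bd : Bd F

lemma Compat.add {F G : Fin 3 → R} (hF : Compat F) (hG : Compat G) : Compat (fun i => F i + G i) :=
  fun i x h => by simp [hF i x h, hG i x h]

lemma Compat.mul {F G : Fin 3 → R} (hF : Compat F) (hG : Compat G) : Compat (fun i => F i * G i) :=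
  fun i x h => by simp [hF i x h, hG i x h]

lemma Compat.pow {F : Fin 3 → R} (hF : Compat F) (n : ℕ) : Compat (fun i => F i ^ n) :=
  fun i x h => by simp [hF i x h]

lemma Compat.Cmul {F : Fin 3 → R} (hF : Compat F) (c : ℝ) : Compat (fun i => C c * F i) :=
  fun i x h => by simp [hF i x h]

lemma compat_mu : Compat mu := by
  intro i x h
  fin_cases i <;> simp [al, mu] at h ⊢ <;> linarith

/-- Hat functions at the vertices. -/
def hat : Fin 3 → Fin 3 → R := ![![al 0, 0, be 2], ![be 0, al 1, 0], ![0, be 1, al 2]]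

lemma compat_hat (j : Fin 3) : Compat (hat j) := by
  intro i x h
  fin_cases i <;> fin_cases j <;> simp [hat, al, be] at h ⊢ <;> linarith

lemma deg_hat (j i : Fin 3) : (hat j i).totalDegree ≤ 1 := by
  have h0 : (0 : R).totalDegree ≤ 1 := by simp
  fin_cases i <;> fin_cases j
  exacts [deg_al 0, deg_be 0, h0, h0, deg_al 1, deg_be 1, deg_be 2, h0, deg_al 2]

lemma compat_bubble (t : Fin 3 → R) (c : Fin 3 → ℝ) :
    Compat (fun i => C (c i) * (al i * be i * t i)) := by
  intro i x h
  have : eval x (be (i + 1)) = 0 := by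
    fin_cases i <;> simp [be, al] at h ⊢ <;> linarith
  simp [h, this]

lemma Adm.add {k} {F G : Fin 3 → R} (hF : Adm k F) (hG : Adm k G) :
    Adm k (fun i => F i + G i) :=
  ⟨fun i => deg_add (hF.deg i) (hG.deg i), hF.compat.add hG.compat,
    fun i x h => by simp [hF.bd i x h, hG.bd i x h]⟩

/-- Gradients of `mu`. -/
def gx : Fin 3 → ℝ := ![0, -3, 3]
def gy : Fin 3 → ℝ := ![3, -3, 0]

lemma pderiv0_mu (i : Fin 3) : pderiv 0 (mu i) = C (gx i) := by
  fin_cases i <;> simp [mu, gx]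

lemma pderiv1_mu (i : Fin 3) : pderiv 1 (mu i) = C (gy i) := by
  fin_cases i <;> simp [mu, gy]

/-- Generic continuous field: vertex part plus edge bubbles. -/
def wf (n : ℕ) (W D : Fin 3 → ℝ) (t : Fin 3 → R) (i : Fin 3) : R :=
  (C (W 0) * hat 0 i ^ n + C (W 1) * hat 1 i ^ n + C (W 2) * hat 2 i ^ n)
    + C (D i) * (al i * be i * t i)

lemma compat_wf (n : ℕ) (W D : Fin 3 → ℝ) (t : Fin 3 → R) : Compat (wf n W D t) :=
  (((((compat_hat 0).pow _).Cmul _).add (((compat_hat 1).pow _).Cmul _)).add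
      (((compat_hat 2).pow _).Cmul _)).add (compat_bubble t D)

lemma deg_wf (n : ℕ) (W D : Fin 3 → ℝ) (t : Fin 3 → R)
    (ht : ∀ i, (al i * be i * t i).totalDegree ≤ n) (i : Fin 3) : (wf n W D t i).totalDegree ≤ n :=
  deg_add (deg_add (deg_add (deg_Cmul (deg_pow (deg_hat _ _) le_rfl))
      (deg_Cmul (deg_pow (deg_hat _ _) le_rfl))) (deg_Cmul (deg_pow (deg_hat _ _) le_rfl)))
      (deg_Cmul (ht i))

lemma wf0 (n : ℕ) (W D : Fin 3 → ℝ) (t : Fin 3 → R) : wf (n + 1) W D t 0 =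
    C (W 0) * al 0 ^ (n + 1) + C (W 1) * be 0 ^ (n + 1) + C (D 0) * (al 0 * be 0 * t 0) := by
  have h0 : hat 0 0 = al 0 := rfl
  have h1 : hat 1 0 = be 0 := rfl
  have h2 : hat 2 0 = 0 := rfl
  rw [wf, h0, h1, h2, zero_pow (Nat.succ_ne_zero n)]; ring

lemma wf1 (n : ℕ) (W D : Fin 3 → ℝ) (t : Fin 3 → R) : wf (n + 1) W D t 1 =
    C (W 1) * al 1 ^ (n + 1) + C (W 2) * be 1 ^ (n + 1) + C (D 1) * (al 1 * be 1 * t 1) := by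
  have h0 : hat 0 1 = 0 := rfl
  have h1 : hat 1 1 = al 1 := rfl
  have h2 : hat 2 1 = be 1 := rfl
  rw [wf, h0, h1, h2, zero_pow (Nat.succ_ne_zero n)]; ring

lemma wf2 (n : ℕ) (W D : Fin 3 → ℝ) (t : Fin 3 → R) : wf (n + 1) W D t 2 =
    C (W 2) * al 2 ^ (n + 1) + C (W 0) * be 2 ^ (n + 1) + C (D 2) * (al 2 * be 2 * t 2) := by
  have h0 : hat 0 2 = be 2 := rfl
  have h1 : hat 1 2 = 0 := rfl
  have h2 : hat 2 2 = al 2 := rfl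
  rw [wf, h0, h1, h2, zero_pow (Nat.succ_ne_zero n)]; ring

lemma comb_aux (S gx gy w1 w2 v1 v2 d1 d2 c d : ℝ) (A B T M : R)
    (h1 : S * (gx * w1 + gy * w2) = c) (h2 : S * (gx * v1 + gy * v2) = d)
    (h3 : S * (gx * d1 + gy * d2) = 1) :
    C c * A + C d * B + T + M = C S * (C gx * (C w1 * A + C v1 * B + C d1 * T)
      + C gy * (C w2 * A + C v2 * B + C d2 * T)) + M := by
  have h3' : (C (S * (gx * d1 + gy * d2)) : R) = 1 := by rw [h3]; simp
  subst h1 h2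
  simp only [C_mul, C_add] at h3' ⊢
  linear_combination -T * h3'

lemma main_step (r s : ℕ) (q : Fin 3 → R) (hq : ∀ i, (q i).totalDegree ≤ r + 1) :
    ∃ wx wy : Fin 3 → R, Compat wx ∧ Compat wy ∧ (∀ i, (wx i).totalDegree ≤ r + 1) ∧
      (∀ i, (wy i).totalDegree ≤ r + 1) ∧ ∃ g : Fin 3 → R, (∀ i, (g i).totalDegree ≤ r) ∧
      ∀ i, q i = C ((s : ℝ) + 1) * (C (gx i) * wx i + C (gy i) * wy i) + mu i * g i := by
  choose c d t g ht hg e using fun i => edge_decomp r i (q i) (hq i)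
  have hs : ((s : ℝ) + 1) ≠ 0 := by positivity
  obtain ⟨z, hz3⟩ : ∃ z : ℝ, (s + 1) * (3 * z) = 1 := ⟨((s : ℝ) + 1)⁻¹ / 3, by field_simp⟩
  refine ⟨wf (r + 1) ![z * d 2, -z * c 1 - z * d 0, z * c 2] ![0, -z, z] t,
    wf (r + 1) ![z * c 0, z * d 0, -z * d 1 - z * c 2] ![z, 0, 0] t,
    compat_wf _ _ _ _, compat_wf _ _ _ _, deg_wf _ _ _ _ ht, deg_wf _ _ _ _ ht, g, hg, ?_⟩
  rw [Fin.forall_fin_succ, Fin.forall_fin_succ, Fin.forall_fin_succ]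
  refine ⟨?_, ?_, ?_, fun i => i.elim0⟩
  · rw [e 0, wf0, wf0]
    apply comb_aux <;> simp [gx, gy]
    · linear_combination c 0 * hz3
    · linear_combination d 0 * hz3
    · linear_combination hz3
  · change q 1 = C ((s : ℝ) + 1) * (C (gx 1) * wf _ _ _ _ 1 + C (gy 1) * wf _ _ _ _ 1) + mu 1 * g 1
    rw [e 1, wf1, wf1]
    apply comb_aux <;> simp [gx, gy]
    · linear_combination c 1 * hz3
    · linear_combination d 1 * hz3
    · linear_combination hz3
  · change q 2 = C ((s : ℝ) + 1) * (C (gx 2) * wf _ _ _ _ 2 + C (gy 2) * wf _ _ _ _ 2) + mu 2 * g 2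
    rw [e 2, wf2, wf2]
    apply comb_aux <;> simp [gx, gy]
    · linear_combination c 2 * hz3
    · linear_combination d 2 * hz3
    · linear_combination hz3

lemma adm_mul {s r k : ℕ} (h : s + 1 + r ≤ k) {w : Fin 3 → R} (hc : Compat w)
    (hd : ∀ i, (w i).totalDegree ≤ r) : Adm k (fun i => mu i ^ (s + 1) * w i) :=
  ⟨fun i => deg_mul (deg_pow (deg_mu i) le_rfl) (hd i) h, (compat_mu.pow _).mul hc,
    fun i x h => by simp [h]⟩

lemma main_alg (r : ℕ) : ∀ (s k : ℕ), r + s + 1 = k → ∀ q : Fin 3 → R,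
    (∀ i, (q i).totalDegree ≤ r) → ∃ F G : Fin 3 → R, Adm k F ∧ Adm k G ∧ ∃ c : ℝ,
      ∀ i, mu i ^ s * q i = pderiv 0 (F i) + pderiv 1 (G i) + C c * mu i ^ (k - 1) := by
  induction r with
  | zero =>
    intro s k hk q hq
    choose e he using fun i => (⟨_, totalDegree_eq_zero_iff_eq_C.mp (Nat.le_zero.mp (hq i))⟩ :
      ∃ e : ℝ, q i = C e)
    have hs : ((s : ℝ) + 1) ≠ 0 := by positivity
    set z : ℝ := ((s : ℝ) + 1)⁻¹ / 3 with hz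
    have hz3 : (s + 1) * (3 * z) = 1 := by rw [hz]; field_simp
    clear_value z
    set m := (e 0 + e 1 + e 2) / 3 with hm
    refine ⟨fun i => mu i ^ (s + 1) * C (z * (e 2 - m)), fun i => mu i ^ (s + 1) * C (z * (e 0 - m)),
      adm_mul (r := 0) (by omega) (fun i x h => by simp) (fun i => deg_C),
      adm_mul (r := 0) (by omega) (fun i x h => by simp) (fun i => deg_C), m, fun i => ?_⟩
    have hks : k - 1 = s := by omega
    rw [he i, hks, pderiv_mul, pderiv_mul, pderiv_pow, pderiv_pow, pderiv0_mu, pderiv1_mu,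
      pderiv_C, pderiv_C]
    apply MvPolynomial.funext
    intro x
    fin_cases i
    · simp [gx, gy]
      linear_combination (-(eval x (mu 0)) ^ s * (e 0 - m)) * hz3
    · simp [gx, gy]
      have : e 1 = 3 * m - e 0 - e 2 := by rw [hm]; ring
      rw [this]
      linear_combination ((eval x (mu 1)) ^ s * (e 0 - m + (e 2 - m))) * hz3
    · simp [gx, gy]
      linear_combination (-(eval x (mu 2)) ^ s * (e 2 - m)) * hz3
  | succ r ih =>
    intro s k hk q hq
    obtain ⟨wx, wy, cx, cy, dx, dy, g, hg, e⟩ := main_step r s q hq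
    obtain ⟨F, G, hF, hG, c, hc⟩ := ih (s + 1) k (by omega)
      (fun i => g i - (pderiv 0 (wx i) + pderiv 1 (wy i)))
      (fun i => deg_sub (hg i) (deg_add (deg_pderiv _ (dx i) _) (deg_pderiv _ (dy i) _)))
    refine ⟨fun i => F i + mu i ^ (s + 1) * wx i, fun i => G i + mu i ^ (s + 1) * wy i,
      hF.add (adm_mul (by omega) cx dx), hG.add (adm_mul (by omega) cy dy), c, fun i => ?_⟩
    have h1 := hc i
    have h2 := e i
    simp only [map_add, pderiv_mul, pderiv_pow, pderiv0_mu, pderiv1_mu]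
    have h3 : (C ((s : ℝ) + 1) : R) = ((s + 1 : ℕ) : R) := by simp
    rw [h3] at h2
    simp only [Nat.add_sub_cancel]
    linear_combination h1 + mu i ^ s * h2

end CT

/-! ## Geometry and piecewise polynomials -/

namespace CT

open MvPolynomial

/-- Evaluation of a polynomial at a point of the plane. -/
def ev (p : R) (x : ℝ × ℝ) : ℝ := eval ![x.1, x.2] p

/-- Closed subtriangles. -/
def Kc (i : Fin 3) : Set (ℝ × ℝ) := {x | 0 ≤ ev (al i) x ∧ 0 ≤ ev (be i) x ∧ 0 ≤ ev (mu i) x}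

/-- Open subtriangles. -/
def Ks (i : Fin 3) : Set (ℝ × ℝ) := {x | 0 < ev (al i) x ∧ 0 < ev (be i) x ∧ 0 < ev (mu i) x}

lemma ev_al0 (x) : ev (al 0) x = 1 - x.1 - 2 * x.2 := by simp [ev, al]
lemma ev_al1 (x) : ev (al 1) x = 2 * x.1 + x.2 - 1 := by simp [ev, al]
lemma ev_al2 (x) : ev (al 2) x = x.2 - x.1 := by simp [ev, al]
lemma ev_be0 (x) : ev (be 0) x = x.1 - x.2 := by simp [ev, be]
lemma ev_be1 (x) : ev (be 1) x = x.1 + 2 * x.2 - 1 := by simp [ev, be]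
lemma ev_be2 (x) : ev (be 2) x = 1 - 2 * x.1 - x.2 := by simp [ev, be]
lemma ev_mu0 (x) : ev (mu 0) x = 3 * x.2 := by simp [ev, mu]
lemma ev_mu1 (x) : ev (mu 1) x = 3 - 3 * x.1 - 3 * x.2 := by simp [ev, mu]
lemma ev_mu2 (x) : ev (mu 2) x = 3 * x.1 := by simp [ev, mu]

lemma forall3 {P : Fin 3 → Prop} (h0 : P 0) (h1 : P 1) (h2 : P 2) : ∀ i, P i := by
  intro i; fin_cases i
  exacts [h0, h1, h2]

lemma hasFDerivAt_ev (p : R) (x : ℝ × ℝ) :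
    HasFDerivAt (ev p) ((ev (pderiv 0 p) x) • ContinuousLinearMap.fst ℝ ℝ ℝ
      + (ev (pderiv 1 p) x) • ContinuousLinearMap.snd ℝ ℝ ℝ) x := by
  induction p using MvPolynomial.induction_on with
  | C a =>
    have : ev (C a) = fun _ => a := by ext; simp [ev]
    rw [this]
    simpa [ev] using hasFDerivAt_const a x
  | add p q hp hq =>
    have : ev (p + q) = fun y => ev p y + ev q y := by ext; simp [ev]
    rw [this]
    refine (hp.add hq).congr_fderiv ?_
    ext <;> simp [ev]
  | mul_X p i hp =>
    have : ev (p * X i) = fun y => ev p y * ev (X i) y := by ext; simp [ev]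
    rw [this]
    fin_cases i
    · have h0 : HasFDerivAt (ev (X 0 : R)) (ContinuousLinearMap.fst ℝ ℝ ℝ) x := by
        have : ev (X 0 : R) = Prod.fst := by ext; simp [ev]
        rw [this]; exact hasFDerivAt_fst
      refine (hp.mul h0).congr_fderiv ?_
      ext <;> simp [ev]
    · have h0 : HasFDerivAt (ev (X 1 : R)) (ContinuousLinearMap.snd ℝ ℝ ℝ) x := by
        have : ev (X 1 : R) = Prod.snd := by ext; simp [ev]
        rw [this]; exact hasFDerivAt_snd
      refine (hp.mul h0).congr_fderiv ?_
      ext <;> simp [ev]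

lemma continuous_ev (p : R) : Continuous (ev p) :=
  continuous_iff_continuousAt.mpr fun x => (hasFDerivAt_ev p x).continuousAt

lemma isClosed_Kc (i : Fin 3) : IsClosed (Kc i) :=
  (isClosed_le continuous_const (continuous_ev _)).inter
    ((isClosed_le continuous_const (continuous_ev _)).inter
      (isClosed_le continuous_const (continuous_ev _)))

lemma isOpen_Ks (i : Fin 3) : IsOpen (Ks i) :=
  (isOpen_lt continuous_const (continuous_ev _)).inter
    ((isOpen_lt continuous_const (continuous_ev _)).inter
      (isOpen_lt continuous_const (continuous_ev _)))

/-- All the barycentric evaluation lemmas unfold into linear inequalities. -/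
lemma mem_Kc0 (x) : x ∈ Kc 0 ↔ 0 ≤ 1 - x.1 - 2 * x.2 ∧ 0 ≤ x.1 - x.2 ∧ 0 ≤ 3 * x.2 := by
  simp only [Kc, Set.mem_ofPred_eq, ev_al0, ev_be0, ev_mu0]
lemma mem_Kc1 (x) : x ∈ Kc 1 ↔ 0 ≤ 2 * x.1 + x.2 - 1 ∧ 0 ≤ x.1 + 2 * x.2 - 1 ∧
    0 ≤ 3 - 3 * x.1 - 3 * x.2 := by
  simp only [Kc, Set.mem_ofPred_eq, ev_al1, ev_be1, ev_mu1]
lemma mem_Kc2 (x) : x ∈ Kc 2 ↔ 0 ≤ x.2 - x.1 ∧ 0 ≤ 1 - 2 * x.1 - x.2 ∧ 0 ≤ 3 * x.1 := by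
  simp only [Kc, Set.mem_ofPred_eq, ev_al2, ev_be2, ev_mu2]
lemma mem_Ks0 (x) : x ∈ Ks 0 ↔ 0 < 1 - x.1 - 2 * x.2 ∧ 0 < x.1 - x.2 ∧ 0 < 3 * x.2 := by
  simp only [Ks, Set.mem_ofPred_eq, ev_al0, ev_be0, ev_mu0]
lemma mem_Ks1 (x) : x ∈ Ks 1 ↔ 0 < 2 * x.1 + x.2 - 1 ∧ 0 < x.1 + 2 * x.2 - 1 ∧
    0 < 3 - 3 * x.1 - 3 * x.2 := by
  simp only [Ks, Set.mem_ofPred_eq, ev_al1, ev_be1, ev_mu1]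
lemma mem_Ks2 (x) : x ∈ Ks 2 ↔ 0 < x.2 - x.1 ∧ 0 < 1 - 2 * x.1 - x.2 ∧ 0 < 3 * x.1 := by
  simp only [Ks, Set.mem_ofPred_eq, ev_al2, ev_be2, ev_mu2]

lemma Ks_sub_Kc (i : Fin 3) : Ks i ⊆ Kc i := fun _ h => ⟨h.1.le, h.2.1.le, h.2.2.le⟩

lemma convex_Kc : ∀ i, Convex ℝ (Kc i) := by
  apply forall3
  · intro x hx y hy a b ha hb hab
    rw [mem_Kc0] at *
    have : b = 1 - a := by linarith
    subst this
    simp only [Prod.fst_add, Prod.snd_add, Prod.smul_fst, Prod.smul_snd, smul_eq_mul]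
    refine ⟨?_, ?_, ?_⟩
    · nlinarith [mul_nonneg ha hx.1, mul_nonneg hb hy.1]
    · nlinarith [mul_nonneg ha hx.2.1, mul_nonneg hb hy.2.1]
    · nlinarith [mul_nonneg ha hx.2.2, mul_nonneg hb hy.2.2]
  · intro x hx y hy a b ha hb hab
    rw [mem_Kc1] at *
    have : b = 1 - a := by linarith
    subst this
    simp only [Prod.fst_add, Prod.snd_add, Prod.smul_fst, Prod.smul_snd, smul_eq_mul]
    refine ⟨?_, ?_, ?_⟩
    · nlinarith [mul_nonneg ha hx.1, mul_nonneg hb hy.1]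
    · nlinarith [mul_nonneg ha hx.2.1, mul_nonneg hb hy.2.1]
    · nlinarith [mul_nonneg ha hx.2.2, mul_nonneg hb hy.2.2]
  · intro x hx y hy a b ha hb hab
    rw [mem_Kc2] at *
    have : b = 1 - a := by linarith
    subst this
    simp only [Prod.fst_add, Prod.snd_add, Prod.smul_fst, Prod.smul_snd, smul_eq_mul]
    refine ⟨?_, ?_, ?_⟩
    · nlinarith [mul_nonneg ha hx.1, mul_nonneg hb hy.1]
    · nlinarith [mul_nonneg ha hx.2.1, mul_nonneg hb hy.2.1]
    · nlinarith [mul_nonneg ha hx.2.2, mul_nonneg hb hy.2.2]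

lemma vtx0 : vtx 0 = (0, 0) := rfl
lemma vtx1 : vtx 1 = (1, 0) := rfl
lemma vtx2 : vtx 2 = (0, 1) := rfl
lemma vtx01 : vtx (0 + 1) = (1, 0) := rfl
lemma vtx11 : vtx (1 + 1) = (0, 1) := rfl
lemma vtx21 : vtx (2 + 1) = (0, 0) := rfl

lemma hull_sub_Kc (i : Fin 3) :
    convexHull ℝ {vtx i, vtx (i + 1), ((1 : ℝ) / 3, (1 : ℝ) / 3)} ⊆ Kc i := by
  apply convexHull_min _ (convex_Kc i)
  revert i
  apply forall3
  · rintro x (rfl | rfl | rfl) <;> rw [mem_Kc0] <;> norm_num [vtx0, vtx1, vtx2, vtx01, vtx11, vtx21]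
  · rintro x (rfl | rfl | rfl) <;> rw [mem_Kc1] <;> norm_num [vtx0, vtx1, vtx2, vtx01, vtx11, vtx21]
  · rintro x (rfl | rfl | rfl) <;> rw [mem_Kc2] <;> norm_num [vtx0, vtx1, vtx2, vtx01, vtx11, vtx21]

lemma three_mem {s : Set (ℝ × ℝ)} (hs : Convex ℝ s) {u v w : ℝ × ℝ} (hu : u ∈ s) (hv : v ∈ s)
    (hw : w ∈ s) {a b c : ℝ} (ha : 0 ≤ a) (hb : 0 ≤ b) (hc : 0 ≤ c) (h : a + b + c = 1) :
    a • u + b • v + c • w ∈ s := by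
  have := hs.sum_mem (t := Finset.univ) (w := ![a, b, c]) (z := ![u, v, w])
    (by intro i _; fin_cases i <;> simpa) (by simp [Fin.sum_univ_three, h])
    (by intro i _; fin_cases i <;> simpa)
  simpa [Fin.sum_univ_three] using this

lemma Ks_sub_ctK (i : Fin 3) : Ks i ⊆ ctK i := by
  apply interior_maximal _ (isOpen_Ks i)
  intro x hx
  have hcv := convex_convexHull ℝ {vtx i, vtx (i + 1), ((1 : ℝ) / 3, (1 : ℝ) / 3)}
  have h := three_mem hcv (subset_convexHull _ _ (by simp : vtx i ∈ _))
    (subset_convexHull _ _ (by simp : vtx (i + 1) ∈ _))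
    (subset_convexHull _ _ (by simp : ((1 : ℝ) / 3, (1 : ℝ) / 3) ∈ _))
    hx.1.le hx.2.1.le hx.2.2.le ?_
  · convert h using 1
    clear h hcv hx
    revert i
    apply forall3
    · ext <;> simp [vtx0, vtx1, vtx2, vtx01, vtx11, vtx21, ev_al0, ev_be0, ev_mu0] <;> ring
    · ext <;> simp [vtx0, vtx1, vtx2, vtx01, vtx11, vtx21, ev_al1, ev_be1, ev_mu1] <;> ring
    · ext <;> simp [vtx0, vtx1, vtx2, vtx01, vtx11, vtx21, ev_al2, ev_be2, ev_mu2] <;> ring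
  · clear hcv hx
    revert i
    apply forall3
    · simp only [ev_al0, ev_be0, ev_mu0]; ring
    · simp only [ev_al1, ev_be1, ev_mu1]; ring
    · simp only [ev_al2, ev_be2, ev_mu2]; ring

lemma ctK_sub_Kc (i : Fin 3) : ctK i ⊆ Kc i := interior_subset.trans (hull_sub_Kc i)

lemma closure_ctK_sub_Kc (i : Fin 3) : closure (ctK i) ⊆ Kc i :=
  closure_minimal (ctK_sub_Kc i) (isClosed_Kc i)

/-- Closed reference triangle. -/
def Tc : Set (ℝ × ℝ) := {x | 0 ≤ x.1 ∧ 0 ≤ x.2 ∧ x.1 + x.2 ≤ 1}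

lemma isClosed_Tc : IsClosed Tc :=
  (isClosed_le continuous_const continuous_fst).inter
    ((isClosed_le continuous_const continuous_snd).inter
      (isClosed_le (continuous_fst.add continuous_snd) continuous_const))

lemma isOpen_Tref : IsOpen Tref :=
  (isOpen_lt continuous_const continuous_fst).inter
    ((isOpen_lt continuous_const continuous_snd).inter
      (isOpen_lt (continuous_fst.add continuous_snd) continuous_const))

lemma Tref_sub_Tc : Tref ⊆ Tc := fun _ h => ⟨h.1.le, h.2.1.le, h.2.2.le⟩

lemma closure_Tref_sub : closure Tref ⊆ Tc := closure_minimal Tref_sub_Tc isClosed_Tc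

lemma isCompact_Tc : IsCompact Tc := by
  apply IsCompact.of_isClosed_subset (isCompact_Icc (a := ((0 : ℝ), (0 : ℝ))) (b := ((1 : ℝ), (1 : ℝ))))
    isClosed_Tc
  rintro ⟨x, y⟩ ⟨h1, h2, h3⟩
  simp only at h1 h2 h3
  exact ⟨⟨h1, h2⟩, ⟨by simp; linarith, by simp; linarith⟩⟩

lemma Tc_sub : Tc ⊆ Kc 0 ∪ (Kc 1 ∪ Kc 2) := by
  rintro x ⟨h1, h2, h3⟩
  simp only [Set.mem_union, mem_Kc0, mem_Kc1, mem_Kc2]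
  by_cases ha : x.2 ≤ x.1
  · by_cases hb : x.1 + 2 * x.2 ≤ 1
    · left; refine ⟨?_, ?_, ?_⟩ <;> linarith
    · right; left; refine ⟨?_, ?_, ?_⟩ <;> linarith
  · by_cases hb : 2 * x.1 + x.2 ≤ 1
    · right; right; refine ⟨?_, ?_, ?_⟩ <;> linarith
    · right; left; refine ⟨?_, ?_, ?_⟩ <;> linarith

lemma Kc_sub_Tc : ∀ i, Kc i ⊆ Tc := by
  apply forall3
  · intro x hx; rw [mem_Kc0] at hx; refine ⟨?_, ?_, ?_⟩ <;> linarith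
  · intro x hx; rw [mem_Kc1] at hx; refine ⟨?_, ?_, ?_⟩ <;> linarith
  · intro x hx; rw [mem_Kc2] at hx; refine ⟨?_, ?_, ?_⟩ <;> linarith

lemma Ks_sub_Tref : ∀ i, Ks i ⊆ Tref := by
  apply forall3
  · intro x hx; rw [mem_Ks0] at hx; refine ⟨?_, ?_, ?_⟩ <;> linarith
  · intro x hx; rw [mem_Ks1] at hx; refine ⟨?_, ?_, ?_⟩ <;> linarith
  · intro x hx; rw [mem_Ks2] at hx; refine ⟨?_, ?_, ?_⟩ <;> linarith

/-- In the open triangle, off the three interior lines, one is in an open subtriangle. -/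
lemma mem_Ks_of_off {x : ℝ × ℝ} (hx : x ∈ Tref) (h1 : x.1 ≠ x.2) (h2 : x.1 + 2 * x.2 ≠ 1)
    (h3 : 2 * x.1 + x.2 ≠ 1) : ∃ i, x ∈ Ks i := by
  obtain ⟨a, b, c⟩ := hx
  rcases lt_or_gt_of_ne h1 with h1 | h1
  · rcases lt_or_gt_of_ne h3 with h3 | h3
    · exact ⟨2, by rw [mem_Ks2]; refine ⟨?_, ?_, ?_⟩ <;> linarith⟩
    · exact ⟨1, by rw [mem_Ks1]; refine ⟨?_, ?_, ?_⟩ <;> linarith⟩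
  · rcases lt_or_gt_of_ne h2 with h2 | h2
    · exact ⟨0, by rw [mem_Ks0]; refine ⟨?_, ?_, ?_⟩ <;> linarith⟩
    · exact ⟨1, by rw [mem_Ks1]; refine ⟨?_, ?_, ?_⟩ <;> linarith⟩

open Classical in
/-- The piecewise polynomial function given by a triple. -/
def pw (F : Fin 3 → R) (x : ℝ × ℝ) : ℝ :=
  if x ∈ Kc 0 then ev (F 0) x else if x ∈ Kc 1 then ev (F 1) x else ev (F 2) x

lemma pw_cases (x : ℝ × ℝ) : ∃ i, ∀ F, pw F x = ev (F i) x := by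
  by_cases h0 : x ∈ Kc 0
  · exact ⟨0, fun F => by simp [pw, h0]⟩
  · by_cases h1 : x ∈ Kc 1
    · exact ⟨1, fun F => by simp [pw, h0, h1]⟩
    · exact ⟨2, fun F => by simp [pw, h0, h1]⟩

lemma pw_cases_Tc {x : ℝ × ℝ} (hx : x ∈ Tc) : ∃ i, x ∈ Kc i ∧ ∀ F, pw F x = ev (F i) x := by
  by_cases h0 : x ∈ Kc 0
  · exact ⟨0, h0, fun F => by simp [pw, h0]⟩
  · by_cases h1 : x ∈ Kc 1
    · exact ⟨1, h1, fun F => by simp [pw, h0, h1]⟩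
    · exact ⟨2, by have := Tc_sub hx; simpa [h0, h1] using this, fun F => by simp [pw, h0, h1]⟩

lemma pw_Ks (F : Fin 3 → R) : ∀ i, ∀ x ∈ Ks i, pw F x = ev (F i) x := by
  apply forall3
  · intro x hx; simp [pw, Ks_sub_Kc 0 hx]
  · intro x hx
    have h0 : x ∉ Kc 0 := by
      rw [mem_Kc0]; rw [mem_Ks1] at hx; rintro ⟨a, b, c⟩; linarith
    simp [pw, h0, Ks_sub_Kc 1 hx]
  · intro x hx
    rw [mem_Ks2] at hx
    have h0 : x ∉ Kc 0 := by
      rw [mem_Kc0]; rintro ⟨a, b, c⟩; linarith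
    have h1 : x ∉ Kc 1 := by
      rw [mem_Kc1]; rintro ⟨a, b, c⟩; linarith
    simp [pw, h0, h1]

lemma pw_Kc {F : Fin 3 → R} (hF : Compat F) : ∀ i, ∀ x ∈ Kc i, pw F x = ev (F i) x := by
  have c0 : ∀ x, ev (al 0) x = 0 → ev (F 0) x = ev (F 1) x := fun x h => hF 0 _ h
  have c1 : ∀ x, ev (al 1) x = 0 → ev (F 1) x = ev (F 2) x := fun x h => hF 1 _ h
  have c2 : ∀ x, ev (al 2) x = 0 → ev (F 2) x = ev (F 0) x := fun x h => hF 2 _ h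
  apply forall3
  · intro x hx; simp [pw, hx]
  · intro x hx
    by_cases h0 : x ∈ Kc 0
    · simp only [pw, h0, if_true]
      apply c0
      rw [mem_Kc0] at h0; rw [mem_Kc1] at hx; rw [ev_al0]; linarith
    · simp [pw, h0, hx]
  · intro x hx
    by_cases h0 : x ∈ Kc 0
    · simp only [pw, h0, if_true]
      symm
      apply c2
      rw [mem_Kc0] at h0; rw [mem_Kc2] at hx; rw [ev_al2]; linarith
    · by_cases h1 : x ∈ Kc 1
      · simp only [pw, h0, h1, if_true, if_false]
        apply c1
        rw [mem_Kc1] at h1; rw [mem_Kc2] at hx; rw [ev_al1]; linarith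
      · simp [pw, h0, h1]

lemma continuousOn_pw {F : Fin 3 → R} (hF : Compat F) : ContinuousOn (pw F) Tc := by
  have h : ∀ i, ContinuousOn (pw F) (Kc i) := fun i =>
    (continuous_ev (F i)).continuousOn.congr (fun x hx => pw_Kc hF i x hx)
  exact ((h 0).union_of_isClosed ((h 1).union_of_isClosed (h 2) (isClosed_Kc 1) (isClosed_Kc 2))
    (isClosed_Kc 0) ((isClosed_Kc 1).union (isClosed_Kc 2))).mono Tc_sub

lemma pw_frontier {F : Fin 3 → R} (hF : Compat F) (hb : Bd F) {x : ℝ × ℝ} (hx : x ∈ Tc)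
    (hx' : x ∉ Tref) : pw F x = 0 := by
  obtain ⟨h1, h2, h3⟩ := hx
  have : ∃ i, x ∈ Kc i ∧ ev (mu i) x = 0 := by
    by_cases a : x.2 = 0
    · exact ⟨0, by rw [mem_Kc0]; refine ⟨?_, ?_, ?_⟩ <;> linarith, by rw [ev_mu0]; linarith⟩
    by_cases b : x.1 = 0
    · exact ⟨2, by rw [mem_Kc2]; refine ⟨?_, ?_, ?_⟩ <;> linarith, by rw [ev_mu2]; linarith⟩
    have c : x.1 + x.2 = 1 := by
      by_contra c
      exact hx' ⟨lt_of_le_of_ne h1 (Ne.symm b), lt_of_le_of_ne h2 (Ne.symm a), lt_of_le_of_ne h3 c⟩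
    exact ⟨1, by rw [mem_Kc1]; refine ⟨?_, ?_, ?_⟩ <;> linarith, by rw [ev_mu1]; linarith⟩
  obtain ⟨i, hi, hm⟩ := this
  rw [pw_Kc hF i x hi]
  exact hb i _ hm

lemma hasFDerivAt_pw (F : Fin 3 → R) {i : Fin 3} {x : ℝ × ℝ} (hx : x ∈ Ks i) :
    HasFDerivAt (pw F) ((pw (fun i => pderiv 0 (F i)) x) • ContinuousLinearMap.fst ℝ ℝ ℝ
      + (pw (fun i => pderiv 1 (F i)) x) • ContinuousLinearMap.snd ℝ ℝ ℝ) x := by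
  rw [pw_Ks _ i x hx, pw_Ks _ i x hx]
  refine (hasFDerivAt_ev (F i) x).congr_of_eventuallyEq ?_
  filter_upwards [(isOpen_Ks i).mem_nhds hx] with y hy using pw_Ks F i y hy

lemma pw_add (F G : Fin 3 → R) (x) : pw (F + G) x = pw F x + pw G x := by
  obtain ⟨i, h⟩ := pw_cases x
  simp [h, ev]

lemma pw_smul (c : ℝ) (F : Fin 3 → R) (x) : pw (c • F) x = c * pw F x := by
  obtain ⟨i, h⟩ := pw_cases x
  simp [h, ev, smul_eval]

lemma pw_mul (F G : Fin 3 → R) (x) : pw (F * G) x = pw F x * pw G x := by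
  obtain ⟨i, h⟩ := pw_cases x
  simp [h, ev]

lemma measurable_pw (F : Fin 3 → R) : Measurable (pw F) := by
  unfold pw
  exact Measurable.ite (isClosed_Kc 0).measurableSet (continuous_ev _).measurable
    (Measurable.ite (isClosed_Kc 1).measurableSet (continuous_ev _).measurable
      (continuous_ev _).measurable)

lemma abs_pw_le (F : Fin 3 → R) (x) : |pw F x| ≤ ∑ i, |ev (F i) x| := by
  obtain ⟨i, h⟩ := pw_cases x
  rw [h]
  exact Finset.single_le_sum (f := fun i => |ev (F i) x|) (fun _ _ => abs_nonneg _)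
    (Finset.mem_univ i)

lemma cont_sum (F : Fin 3 → R) : Continuous (fun x => ∑ i, |ev (F i) x|) :=
  continuous_finsetSum _ fun i _ => (continuous_ev (F i)).abs

lemma pw_bdd (F : Fin 3 → R) : ∃ M, 0 ≤ M ∧ ∀ x ∈ Tc, |pw F x| ≤ M := by
  obtain ⟨M, hM⟩ := isCompact_Tc.exists_bound_of_continuousOn (cont_sum F).continuousOn
  refine ⟨|M|, abs_nonneg _, fun x hx => (abs_pw_le F x).trans ?_⟩
  exact (le_abs_self _).trans ((hM x hx).trans (le_abs_self _))

lemma integrable_pw (F : Fin 3 → R) : IntegrableOn (pw F) Tref := by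
  have : IntegrableOn (fun x => ∑ i, |ev (F i) x|) Tref :=
    ((cont_sum F).continuousOn.integrableOn_compact isCompact_Tc).mono_set Tref_sub_Tc
  exact this.mono' (measurable_pw F).aestronglyMeasurable
    (Filter.Eventually.of_forall fun x => abs_pw_le F x)

/-- The integral over the triangle, as a linear functional. -/
def J : (Fin 3 → R) →ₗ[ℝ] ℝ where
  toFun F := ∫ x in Tref, pw F x
  map_add' F G := by
    simp only [pw_add]
    exact integral_add (integrable_pw F) (integrable_pw G)
  map_smul' c F := by
    simp only [pw_smul, RingHom.id_apply, smul_eq_mul]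
    exact integral_const_mul _ _

lemma J_apply (F) : J F = ∫ x in Tref, pw F x := rfl

end CT

/-! ## Measure-theoretic part -/

namespace CT

open MvPolynomial

lemma line_null (a b c : ℝ) (hb : b ≠ 0) : volume {x : ℝ × ℝ | a * x.1 + b * x.2 = c} = 0 := by
  have hm : MeasurableSet {x : ℝ × ℝ | a * x.1 + b * x.2 = c} :=
    (isClosed_eq (by fun_prop) continuous_const).measurableSet
  rw [Measure.volume_eq_prod, Measure.measure_prod_null hm]
  refine Filter.Eventually.of_forall fun x => ?_
  have : (Prod.mk x ⁻¹' {x : ℝ × ℝ | a * x.1 + b * x.2 = c}) ⊆ {(c - a * x) / b} := by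
    intro y hy
    have hy : a * x + b * y = c := hy
    rw [Set.mem_singleton_iff, eq_div_iff hb]; linarith
  exact measure_mono_null this (by simp)

lemma ae_Ks : ∀ᵐ x ∂(volume.restrict Tref), ∃ i, x ∈ Ks i := by
  rw [ae_restrict_iff' isOpen_Tref.measurableSet]
  have h1 := measure_eq_zero_iff_ae_notMem.mp (line_null 1 (-1) 0 (by norm_num))
  have h2 := measure_eq_zero_iff_ae_notMem.mp (line_null 1 2 1 (by norm_num))
  have h3 := measure_eq_zero_iff_ae_notMem.mp (line_null 2 1 1 (by norm_num))
  filter_upwards [h1, h2, h3] with x h1 h2 h3 hx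
  refine mem_Ks_of_off hx (fun h => h1 ?_) (fun h => h2 ?_) (fun h => h3 ?_)
  · change 1 * x.1 + -1 * x.2 = 0; linarith
  · change 1 * x.1 + 2 * x.2 = 1; linarith
  · change 2 * x.1 + 1 * x.2 = 1; linarith

lemma intervalIntegrable_pw_x (F : Fin 3 → R) (y a b : ℝ) :
    IntervalIntegrable (fun x => pw F (x, y)) volume a b := by
  have h : Continuous (fun x : ℝ => ∑ i, |ev (F i) (x, y)|) :=
    (cont_sum F).comp (Continuous.prodMk_left y)
  exact (h.intervalIntegrable a b).mono_fun
    ((measurable_pw F).comp measurable_prodMk_right).aestronglyMeasurable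
    (Filter.Eventually.of_forall fun x => (abs_pw_le F (x, y)).trans (le_abs_self _))

lemma intervalIntegrable_pw_y (F : Fin 3 → R) (x a b : ℝ) :
    IntervalIntegrable (fun y => pw F (x, y)) volume a b := by
  have h : Continuous (fun y : ℝ => ∑ i, |ev (F i) (x, y)|) :=
    (cont_sum F).comp (Continuous.prodMk_right x)
  exact (h.intervalIntegrable a b).mono_fun
    ((measurable_pw F).comp measurable_prodMk_left).aestronglyMeasurable
    (Filter.Eventually.of_forall fun y => (abs_pw_le F (x, y)).trans (le_abs_self _))

lemma J_pderiv0 {k : ℕ} {F : Fin 3 → R} (hF : Adm k F) : J (fun i => pderiv 0 (F i)) = 0 := by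
  rw [J_apply, ← integral_indicator isOpen_Tref.measurableSet, Measure.volume_eq_prod,
    integral_prod_symm]
  swap
  · rw [← Measure.volume_eq_prod]
    exact (integrable_pw _).integrable_indicator isOpen_Tref.measurableSet
  apply integral_eq_zero_of_ae
  refine Filter.Eventually.of_forall fun y => ?_
  simp only [Pi.zero_apply]
  by_cases hy : 0 < y ∧ y < 1
  · obtain ⟨hy0, hy1⟩ := hy
    have e1 : (fun x => Tref.indicator (pw fun i => pderiv 0 (F i)) (x, y))
        = (Ioo 0 (1 - y)).indicator (fun x => pw (fun i => pderiv 0 (F i)) (x, y)) := by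
      ext x
      have : (x, y) ∈ Tref ↔ x ∈ Ioo 0 (1 - y) := by
        constructor
        · rintro ⟨a, b, c⟩; simp only at a b c; exact ⟨a, by linarith⟩
        · rintro ⟨a, b⟩; exact ⟨a, hy0, by simp only; linarith⟩
      by_cases h : x ∈ Ioo 0 (1 - y)
      · rw [indicator_of_mem h, indicator_of_mem (this.mpr h)]
      · rw [indicator_of_notMem h, indicator_of_notMem (fun h' => h (this.mp h'))]
    rw [e1, integral_indicator measurableSet_Ioo, ← integral_Ioc_eq_integral_Ioo,
      ← intervalIntegral.integral_of_le (by linarith)]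
    rw [integral_eq_of_hasDerivAt_off_countable_of_le (fun x => pw F (x, y)) _ (by linarith)
      (s := {y, 1 - 2 * y, (1 - y) / 2}) ((Set.toFinite _).countable) ?_ ?_
      (intervalIntegrable_pw_x _ _ _ _)]
    · rw [pw_frontier hF.compat hF.bd (x := (1 - y, y)), pw_frontier hF.compat hF.bd (x := (0, y)),
        sub_zero]
      · exact ⟨le_rfl, hy0.le, by simp only; linarith⟩
      · rintro ⟨a, b, c⟩; simp at a
      · exact ⟨by simp only; linarith, hy0.le, by simp only; linarith⟩
      · rintro ⟨a, b, c⟩; simp at c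
    · refine (continuousOn_pw hF.compat).comp (Continuous.prodMk_left y).continuousOn ?_
      rintro x ⟨a, b⟩
      exact ⟨a, hy0.le, by simp only; linarith⟩
    · rintro x ⟨⟨a, b⟩, hx⟩
      simp only [Set.mem_insert_iff, Set.mem_singleton_iff, not_or] at hx
      obtain ⟨i, hi⟩ := mem_Ks_of_off (x := (x, y)) ⟨a, hy0, by simp only; linarith⟩ hx.1
        (fun h => hx.2.1 (by simp only at h; linarith))
        (fun h => hx.2.2 (by simp only at h; linarith))
      have := (hasFDerivAt_pw F hi).comp_hasDerivAt x
        ((hasDerivAt_id x).prodMk (hasDerivAt_const x y))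
      simp at this; exact this
  · rw [show (fun x => Tref.indicator (pw fun i => pderiv 0 (F i)) (x, y)) = fun _ => 0 from ?_]
    · simp
    · ext x
      apply indicator_of_notMem
      rintro ⟨a, b, c⟩
      simp only at a b c
      exact hy ⟨b, by linarith⟩

lemma J_pderiv1 {k : ℕ} {F : Fin 3 → R} (hF : Adm k F) : J (fun i => pderiv 1 (F i)) = 0 := by
  rw [J_apply, ← integral_indicator isOpen_Tref.measurableSet, Measure.volume_eq_prod,
    integral_prod]
  swap
  · rw [← Measure.volume_eq_prod]
    exact (integrable_pw _).integrable_indicator isOpen_Tref.measurableSet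
  apply integral_eq_zero_of_ae
  refine Filter.Eventually.of_forall fun x => ?_
  simp only [Pi.zero_apply]
  by_cases hx : 0 < x ∧ x < 1
  · obtain ⟨hx0, hx1⟩ := hx
    have e1 : (fun y => Tref.indicator (pw fun i => pderiv 1 (F i)) (x, y))
        = (Ioo 0 (1 - x)).indicator (fun y => pw (fun i => pderiv 1 (F i)) (x, y)) := by
      ext y
      have : (x, y) ∈ Tref ↔ y ∈ Ioo 0 (1 - x) := by
        constructor
        · rintro ⟨a, b, c⟩; simp only at a b c; exact ⟨b, by linarith⟩
        · rintro ⟨a, b⟩; exact ⟨hx0, a, by simp only; linarith⟩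
      by_cases h : y ∈ Ioo 0 (1 - x)
      · rw [indicator_of_mem h, indicator_of_mem (this.mpr h)]
      · rw [indicator_of_notMem h, indicator_of_notMem (fun h' => h (this.mp h'))]
    rw [e1, integral_indicator measurableSet_Ioo, ← integral_Ioc_eq_integral_Ioo,
      ← intervalIntegral.integral_of_le (by linarith)]
    rw [integral_eq_of_hasDerivAt_off_countable_of_le (fun y => pw F (x, y)) _ (by linarith)
      (s := {x, 1 - 2 * x, (1 - x) / 2}) ((Set.toFinite _).countable) ?_ ?_
      (intervalIntegrable_pw_y _ _ _ _)]
    · rw [pw_frontier hF.compat hF.bd (x := (x, 1 - x)), pw_frontier hF.compat hF.bd (x := (x, 0)),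
        sub_zero]
      · exact ⟨hx0.le, le_rfl, by simp only; linarith⟩
      · rintro ⟨a, b, c⟩; simp at b
      · exact ⟨hx0.le, by simp only; linarith, by simp only; linarith⟩
      · rintro ⟨a, b, c⟩; simp at c
    · refine (continuousOn_pw hF.compat).comp (Continuous.prodMk_right x).continuousOn ?_
      rintro y ⟨a, b⟩
      exact ⟨hx0.le, a, by simp only; linarith⟩
    · rintro y ⟨⟨a, b⟩, hy⟩
      simp only [Set.mem_insert_iff, Set.mem_singleton_iff, not_or] at hy
      obtain ⟨i, hi⟩ := mem_Ks_of_off (x := (x, y)) ⟨hx0, a, by simp only; linarith⟩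
        (fun h => hy.1 h.symm)
        (fun h => hy.2.2 (by simp only at h; linarith))
        (fun h => hy.2.1 (by simp only at h; linarith))
      have := (hasFDerivAt_pw F hi).comp_hasDerivAt y
        ((hasDerivAt_const y x).prodMk (hasDerivAt_id y))
      simp at this; exact this
  · rw [show (fun y => Tref.indicator (pw fun i => pderiv 1 (F i)) (x, y)) = fun _ => 0 from ?_]
    · simp
    · ext y
      apply indicator_of_notMem
      rintro ⟨a, b, c⟩
      simp only at a b c
      exact hx ⟨a, by linarith⟩

lemma vol_Tref_pos : 0 < volume Tref :=
  isOpen_Tref.measure_pos _ ⟨(1 / 4, 1 / 4), by norm_num, by norm_num, by norm_num⟩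

lemma vol_Tref_lt : volume Tref < ⊤ :=
  (measure_mono Tref_sub_Tc).trans_lt isCompact_Tc.measure_lt_top

lemma mu_pos {x : ℝ × ℝ} (hx : x ∈ Tref) : ∀ i, 0 < ev (mu i) x := by
  obtain ⟨a, b, c⟩ := hx
  apply forall3
  · rw [ev_mu0]; linarith
  · rw [ev_mu1]; linarith
  · rw [ev_mu2]; linarith

lemma J_mu_pos (n : ℕ) : 0 < J (fun i => mu i ^ n) := by
  rw [J_apply]
  have hp : ∀ x ∈ Tref, 0 < pw (fun i => mu i ^ n) x := by
    intro x hx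
    obtain ⟨i, h⟩ := pw_cases x
    rw [h]
    have := pow_pos (mu_pos hx i) n
    simpa [ev] using this
  rw [setIntegral_pos_iff_support_of_nonneg_ae _ (integrable_pw _)]
  · refine vol_Tref_pos.trans_le (measure_mono fun x hx => ⟨(hp x hx).ne', hx⟩)
  · filter_upwards [ae_restrict_mem isOpen_Tref.measurableSet] with x hx using (hp x hx).le

lemma Ks_nonempty : ∀ i, (Ks i).Nonempty := by
  apply forall3
  · exact ⟨(1 / 3, 1 / 6), by rw [mem_Ks0]; norm_num⟩
  · exact ⟨(2 / 5, 2 / 5), by rw [mem_Ks1]; norm_num⟩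
  · exact ⟨(1 / 6, 1 / 3), by rw [mem_Ks2]; norm_num⟩

lemma eq_zero_of_open {p : R} {U : Set (ℝ × ℝ)} (hU : IsOpen U) (hne : U.Nonempty)
    (h : ∀ x ∈ U, ev p x = 0) : p = 0 := by
  obtain ⟨⟨a, b⟩, hx⟩ := hne
  obtain ⟨u, v, hu, hv, hau, hbv, huv⟩ := isOpen_prod_iff.mp hU a b hx
  refine MvPolynomial.funext_set ![u, v] ?_ ?_
  · intro i
    fin_cases i
    · exact infinite_of_mem_nhds a (hu.mem_nhds hau)
    · exact infinite_of_mem_nhds b (hv.mem_nhds hbv)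
  · intro x hx
    have h0 := hx 0 (mem_univ _)
    have h1 := hx 1 (mem_univ _)
    have := h (x 0, x 1) (huv ⟨h0, h1⟩)
    have e : ![x 0, x 1] = x := by ext i; fin_cases i <;> rfl
    simpa [ev, e] using this

lemma J_sq_nonneg (p : Fin 3 → R) : 0 ≤ J (p * p) := by
  rw [J_apply]
  exact integral_nonneg fun x => by rw [pw_mul]; exact mul_self_nonneg _

lemma J_sq_pos {p : Fin 3 → R} (hp : p ≠ 0) : 0 < J (p * p) := by
  refine lt_of_le_of_ne (J_sq_nonneg p) (fun h => hp ?_)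
  rw [J_apply, eq_comm, integral_eq_zero_iff_of_nonneg
    (fun x => by rw [pw_mul]; exact mul_self_nonneg _) (integrable_pw _)] at h
  funext i
  refine eq_zero_of_open (isOpen_Ks i) (Ks_nonempty i) ?_
  have h2 : ev (p i) =ᵐ[volume.restrict (Ks i)] fun _ => 0 := by
    have h' := ae_restrict_of_ae_restrict_of_subset (Ks_sub_Tref i) h
    filter_upwards [h', ae_restrict_mem (isOpen_Ks i).measurableSet] with x hx hK
    rw [pw_mul, pw_Ks p i x hK] at hx
    exact mul_self_eq_zero.mp hx
  exact Measure.eqOn_open_of_ae_eq h2 (isOpen_Ks i) (continuous_ev _).continuousOn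
    continuousOn_const

/-- Algebraic surjectivity of the divergence. -/
lemma surj {k : ℕ} (hk : 1 ≤ k) (q : Fin 3 → R) (hq : ∀ i, (q i).totalDegree ≤ k - 1)
    (h0 : J q = 0) : ∃ F G : Fin 3 → R, Adm k F ∧ Adm k G ∧
      ∀ i, q i = pderiv 0 (F i) + pderiv 1 (G i) := by
  obtain ⟨F, G, hF, hG, c, hc⟩ := main_alg (k - 1) 0 k (by omega) q hq
  refine ⟨F, G, hF, hG, fun i => ?_⟩
  have e : q = (fun i => pderiv 0 (F i)) + (fun i => pderiv 1 (G i))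
      + c • (fun i => mu i ^ (k - 1)) := by
    funext i
    have := hc i
    simpa [smul_eq_C_mul] using this
  have h1 : c * J (fun i => mu i ^ (k - 1)) = 0 := by
    rw [e, map_add, map_add, map_smul, J_pderiv0 hF, J_pderiv1 hG] at h0
    simpa using h0
  have hc0 : c = 0 := by
    rcases mul_eq_zero.mp h1 with h | h
    · exact h
    · exact absurd h (J_mu_pos _).ne'
  have := hc i
  simpa [hc0] using this

end CT

/-! ## Finite-dimensional bounds -/

namespace CT

open MvPolynomial

lemma pw_sum {n : ℕ} (c : Fin n → ℝ) (H : Fin n → Fin 3 → R) (x) :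
    pw (∑ j, c j • H j) x = ∑ j, c j * pw (H j) x := by
  obtain ⟨i, h⟩ := pw_cases x
  simp [h, ev, Finset.sum_apply, smul_eval]

lemma lin_bound {n : ℕ} (H : Fin n → Fin 3 → R) :
    ∃ M, 0 ≤ M ∧ ∀ (c : Fin n → ℝ), ∀ x ∈ Tc, |pw (∑ j, c j • H j) x| ≤ M * ‖c‖ := by
  choose M hM0 hM using fun j => pw_bdd (H j)
  refine ⟨∑ j, M j, Finset.sum_nonneg fun j _ => hM0 j, fun c x hx => ?_⟩
  rw [pw_sum, Finset.sum_mul]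
  refine (Finset.abs_sum_le_sum_abs _ _).trans (Finset.sum_le_sum fun j _ => ?_)
  rw [abs_mul, mul_comm]
  exact mul_le_mul (hM j x hx) (norm_le_pi_norm c j) (abs_nonneg _) (hM0 j)

lemma J_quad {n : ℕ} (e : Fin n → Fin 3 → R) (c : Fin n → ℝ) :
    J ((∑ j, c j • e j) * (∑ j, c j • e j)) = ∑ j, ∑ l, c j * c l * J (e j * e l) := by
  rw [Finset.sum_mul_sum, map_sum]
  refine Finset.sum_congr rfl fun j _ => ?_
  rw [map_sum]
  refine Finset.sum_congr rfl fun l _ => ?_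
  rw [smul_mul_smul_comm, map_smul, smul_eq_mul]

lemma coercive {n : ℕ} (e : Fin n → Fin 3 → R) (h : LinearIndependent ℝ e) :
    ∃ m, 0 < m ∧ ∀ c : Fin n → ℝ, m * ‖c‖ ^ 2 ≤ J ((∑ j, c j • e j) * (∑ j, c j • e j)) := by
  by_cases hn : ∃ c : Fin n → ℝ, c ≠ 0
  · obtain ⟨c1, hc1⟩ := hn
    have hcont : Continuous (fun c : Fin n → ℝ => J ((∑ j, c j • e j) * (∑ j, c j • e j))) := by
      simp only [J_quad]
      fun_prop
    have hne : (Metric.sphere (0 : Fin n → ℝ) 1).Nonempty := by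
      refine ⟨‖c1‖⁻¹ • c1, ?_⟩
      rw [mem_sphere_zero_iff_norm, norm_smul, norm_inv, norm_norm,
        inv_mul_cancel₀ (norm_ne_zero_iff.mpr hc1)]
    obtain ⟨c0, hc0, hmin⟩ := (isCompact_sphere (0 : Fin n → ℝ) 1).exists_isMinOn hne
      hcont.continuousOn
    refine ⟨J ((∑ j, c0 j • e j) * (∑ j, c0 j • e j)), J_sq_pos ?_, ?_⟩
    · intro hz
      have hz' := Fintype.linearIndependent_iff.mp h c0 hz
      have : c0 = 0 := funext hz'
      rw [mem_sphere_zero_iff_norm, this, norm_zero] at hc0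
      exact zero_ne_one hc0
    · intro c
      by_cases hc : c = 0
      · subst hc; simp
      · have hcn : ‖c‖ ≠ 0 := norm_ne_zero_iff.mpr hc
        have hm : (‖c‖⁻¹ • c) ∈ Metric.sphere (0 : Fin n → ℝ) 1 := by
          rw [mem_sphere_zero_iff_norm, norm_smul, norm_inv, norm_norm, inv_mul_cancel₀ hcn]
        have h1 := hmin hm
        have h1 : J ((∑ j, c0 j • e j) * (∑ j, c0 j • e j))
          ≤ J ((∑ j, (‖c‖⁻¹ • c) j • e j) * (∑ j, (‖c‖⁻¹ • c) j • e j)) := h1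
        have h2 : (∑ j, (‖c‖⁻¹ • c) j • e j) = ‖c‖⁻¹ • ∑ j, c j • e j := by
          rw [Finset.smul_sum]
          refine Finset.sum_congr rfl fun j _ => ?_
          rw [Pi.smul_apply, smul_assoc]
        rw [h2, smul_mul_smul_comm, map_smul, smul_eq_mul] at h1
        calc _ ≤ (‖c‖⁻¹ * ‖c‖⁻¹ * J ((∑ j, c j • e j) * (∑ j, c j • e j))) * ‖c‖ ^ 2 :=
              mul_le_mul_of_nonneg_right h1 (sq_nonneg _)
          _ = _ := by field_simp
  · refine ⟨1, one_pos, fun c => ?_⟩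
    have : c = 0 := by by_contra h; exact hn ⟨c, h⟩
    subst this; simp

lemma Adm.smul {k : ℕ} {F : Fin 3 → R} (hF : Adm k F) (c : ℝ) : Adm k (c • F) := by
  refine ⟨fun i => ?_, fun i x h => ?_, fun i x h => ?_⟩
  · rw [Pi.smul_apply, smul_eq_C_mul]; exact deg_Cmul (hF.deg i)
  · simp [smul_eval, hF.compat i x h]
  · simp [smul_eval, hF.bd i x h]

lemma Adm.sum {k n : ℕ} {F : Fin n → Fin 3 → R} (hF : ∀ j, Adm k (F j)) (c : Fin n → ℝ) :
    Adm k (∑ j, c j • F j) := by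
  refine Finset.sum_induction _ (Adm k) (fun _ _ h h' => h.add h') ?_ fun j _ => (hF j).smul (c j)
  exact ⟨fun i => by simp, fun i x h => by simp, fun i x h => by simp⟩

lemma pderiv_sum {n : ℕ} (l : Fin 2) (F : Fin n → Fin 3 → R) (c : Fin n → ℝ) :
    (fun i => pderiv l ((∑ j, c j • F j) i)) = ∑ j, c j • (fun i => pderiv l (F j i)) := by
  funext i
  simp [Finset.sum_apply]

lemma norm_fderiv_le {P Q : Fin 3 → R} {i : Fin 3} {x : ℝ × ℝ} (hx : x ∈ Ks i) :
    ‖fderiv ℝ (fun x => (pw P x, pw Q x)) x‖ ≤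
      |pw (fun i => pderiv 0 (P i)) x| + |pw (fun i => pderiv 1 (P i)) x|
      + (|pw (fun i => pderiv 0 (Q i)) x| + |pw (fun i => pderiv 1 (Q i)) x|) := by
  rw [((hasFDerivAt_pw P hx).prodMk (hasFDerivAt_pw Q hx)).fderiv]
  apply ContinuousLinearMap.opNorm_le_bound _ (by positivity)
  intro y
  have key : ∀ a b : ℝ, |a * y.1 + b * y.2| ≤ (|a| + |b|) * ‖y‖ := by
    intro a b
    have h1 : |y.1| ≤ ‖y‖ := norm_fst_le y
    have h2 : |y.2| ≤ ‖y‖ := norm_snd_le y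
    calc _ ≤ |a * y.1| + |b * y.2| := abs_add_le _ _
      _ = |a| * |y.1| + |b| * |y.2| := by rw [abs_mul, abs_mul]
      _ ≤ |a| * ‖y‖ + |b| * ‖y‖ := by gcongr
      _ = _ := by ring
  have k1 := key (pw (fun i => pderiv 0 (P i)) x) (pw (fun i => pderiv 1 (P i)) x)
  have k2 := key (pw (fun i => pderiv 0 (Q i)) x) (pw (fun i => pderiv 1 (Q i)) x)
  rw [add_mul]
  simp only [ContinuousLinearMap.prod_apply, Prod.norm_mk, ContinuousLinearMap.add_apply,
    ContinuousLinearMap.smul_apply, ContinuousLinearMap.coe_fst', ContinuousLinearMap.coe_snd',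
    smul_eq_mul, Real.norm_eq_abs]
  refine max_le (k1.trans ?_) (k2.trans ?_)
  · exact le_add_of_nonneg_right (by positivity)
  · exact le_add_of_nonneg_left (by positivity)

/-- Energy bound for linear combinations. -/
lemma energy_bound {n : ℕ} (F G : Fin n → Fin 3 → R) : ∃ M, 0 ≤ M ∧ ∀ c : Fin n → ℝ,
    (∫ x in Tref, (‖((pw (∑ j, c j • F j) x, pw (∑ j, c j • G j) x) : ℝ × ℝ)‖ ^ 2
      + ‖fderiv ℝ (fun x => (pw (∑ j, c j • F j) x, pw (∑ j, c j • G j) x)) x‖ ^ 2))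
      ≤ M * ‖c‖ ^ 2 := by
  obtain ⟨M1, p1, h1⟩ := lin_bound F
  obtain ⟨M2, p2, h2⟩ := lin_bound G
  obtain ⟨M3, p3, h3⟩ := lin_bound (fun j i => pderiv 0 (F j i))
  obtain ⟨M4, p4, h4⟩ := lin_bound (fun j i => pderiv 1 (F j i))
  obtain ⟨M5, p5, h5⟩ := lin_bound (fun j i => pderiv 0 (G j i))
  obtain ⟨M6, p6, h6⟩ := lin_bound (fun j i => pderiv 1 (G j i))
  refine ⟨((M1 + M2) ^ 2 + (M3 + M4 + (M5 + M6)) ^ 2) * volume.real Tref, by positivity,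
    fun c => ?_⟩
  have hqint : IntegrableOn (fun _ : ℝ × ℝ =>
      ((M1 + M2) ^ 2 + (M3 + M4 + (M5 + M6)) ^ 2) * ‖c‖ ^ 2) Tref :=
    integrableOn_const vol_Tref_lt.ne
  refine (integral_mono_of_nonneg (Filter.Eventually.of_forall fun x => ?_) hqint ?_).trans ?_
  · simp only [Pi.zero_apply]; positivity
  · filter_upwards [ae_Ks] with x hx
    obtain ⟨i, hi⟩ := hx
    have hT : x ∈ Tc := Tref_sub_Tc (Ks_sub_Tref i hi)
    have b1 : ‖((pw (∑ j, c j • F j) x, pw (∑ j, c j • G j) x) : ℝ × ℝ)‖ ≤ (M1 + M2) * ‖c‖ := by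
      rw [Prod.norm_mk, add_mul]
      refine max_le ((h1 c x hT).trans ?_) ((h2 c x hT).trans ?_)
      · exact le_add_of_nonneg_right (by positivity)
      · exact le_add_of_nonneg_left (by positivity)
    have b2 : ‖fderiv ℝ (fun x => (pw (∑ j, c j • F j) x, pw (∑ j, c j • G j) x)) x‖
        ≤ (M3 + M4 + (M5 + M6)) * ‖c‖ := by
      refine (norm_fderiv_le hi).trans ?_
      rw [pderiv_sum, pderiv_sum, pderiv_sum, pderiv_sum, add_mul, add_mul, add_mul]
      exact add_le_add (add_le_add (h3 c x hT) (h4 c x hT)) (add_le_add (h5 c x hT) (h6 c x hT))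
    calc _ ≤ ((M1 + M2) * ‖c‖) ^ 2 + ((M3 + M4 + (M5 + M6)) * ‖c‖) ^ 2 := by gcongr
      _ = _ := by ring
  · rw [setIntegral_const, smul_eq_mul]
    exact le_of_eq (by ring)

end CT


namespace CT

open MvPolynomial

/-- Mean-zero piecewise polynomials of degree at most `k - 1`. -/
def meanZero (k : ℕ) : Submodule ℝ (Fin 3 → R) :=
  Submodule.pi Set.univ (fun _ => restrictTotalDegree (Fin 2) ℝ (k - 1)) ⊓ LinearMap.ker J

lemma mem_meanZero {k : ℕ} {p : Fin 3 → R} :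
    p ∈ meanZero k ↔ (∀ i, (p i).totalDegree ≤ k - 1) ∧ J p = 0 := by
  simp [meanZero, mem_restrictTotalDegree]

instance finite_restrict (n : ℕ) : Module.Finite ℝ (restrictTotalDegree (Fin 2) ℝ n) := by
  infer_instance

instance finite_meanZero (k : ℕ) : Module.Finite ℝ (meanZero k) := by
  let f : meanZero k →ₗ[ℝ] (Fin 3 → restrictTotalDegree (Fin 2) ℝ (k - 1)) :=
    { toFun := fun p i => ⟨p.1 i,
        (mem_restrictTotalDegree _ _ _).mpr ((mem_meanZero.mp p.2).1 i)⟩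
      map_add' := fun _ _ => rfl
      map_smul' := fun _ _ => rfl }
  refine Module.Finite.of_injective f fun p p' h => ?_
  apply Subtype.ext
  funext i
  exact congrArg Subtype.val (congrFun h i)

lemma exists_basis (k : ℕ) : ∃ (n : ℕ) (e : Fin n → Fin 3 → R), LinearIndependent ℝ e ∧
    (∀ j i, (e j i).totalDegree ≤ k - 1) ∧ (∀ j, J (e j) = 0) ∧
    ∀ p : Fin 3 → R, (∀ i, (p i).totalDegree ≤ k - 1) → J p = 0 →
      ∃ c : Fin n → ℝ, p = ∑ j, c j • e j := by
  let b := Module.finBasis ℝ (meanZero k)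
  refine ⟨_, fun j => (b j : Fin 3 → R), ?_, fun j => (mem_meanZero.mp (b j).2).1,
    fun j => (mem_meanZero.mp (b j).2).2, fun p hp hJ => ?_⟩
  · exact b.linearIndependent.map' (meanZero k).subtype (Submodule.ker_subtype _)
  · refine ⟨fun j => b.repr ⟨p, mem_meanZero.mpr ⟨hp, hJ⟩⟩ j, ?_⟩
    have h1 := congrArg (meanZero k).subtype (b.sum_repr ⟨p, mem_meanZero.mpr ⟨hp, hJ⟩⟩)
    rw [map_sum] at h1
    exact h1.symm

end CT

open CT

/-- Surjectivity, with bounded right inverse, of the divergence operator from continuous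
piecewise degree-k vector fields vanishing on ∂T̂ onto mean-zero piecewise degree-(k−1)
polynomials on the Clough–Tocher split of the reference triangle. -/
theorem stmt11 (k : ℕ) (hk : 2 ≤ k) :
    ∃ C : ℝ, 0 < C ∧ ∀ q : ℝ × ℝ → ℝ,
      (∀ i : Fin 3, ∃ p : MvPolynomial (Fin 2) ℝ, p.totalDegree ≤ k - 1 ∧
        ∀ x ∈ ctK i, q x = MvPolynomial.eval ![x.1, x.2] p) →
      (∫ x in Tref, q x) = 0 →
      ∃ v : ℝ × ℝ → ℝ × ℝ,
        ContinuousOn v (closure Tref) ∧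
        (∀ x ∈ frontier Tref, v x = 0) ∧
        (∀ i : Fin 3, ∃ P Q : MvPolynomial (Fin 2) ℝ,
          P.totalDegree ≤ k ∧ Q.totalDegree ≤ k ∧
          ∀ x ∈ closure (ctK i),
            v x = (MvPolynomial.eval ![x.1, x.2] P, MvPolynomial.eval ![x.1, x.2] Q)) ∧
        (∀ i : Fin 3, ∀ x ∈ ctK i, pdiv v x = q x) ∧
        (∫ x in Tref, (‖v x‖ ^ 2 + ‖fderiv ℝ v x‖ ^ 2)) ≤ C ^ 2 * ∫ x in Tref, (q x) ^ 2 := by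
  obtain ⟨n, e, hli, hdeg, hJ0, hspan⟩ := exists_basis k
  choose F G hF hG hdiv using fun j => surj (by omega : 1 ≤ k) (e j) (hdeg j) (hJ0 j)
  obtain ⟨m, hm, hco⟩ := coercive e hli
  obtain ⟨M, hM, hen⟩ := energy_bound F G
  refine ⟨Real.sqrt (M / m + 1), Real.sqrt_pos.mpr (by positivity), ?_⟩
  intro q hq hqint
  choose p hpd hpq using hq
  have hae : ∀ᵐ x ∂(volume.restrict Tref), q x = pw p x := by
    filter_upwards [ae_Ks] with x hx
    obtain ⟨i, hi⟩ := hx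
    rw [pw_Ks p i x hi, hpq i x (Ks_sub_ctK i hi)]
    rfl
  have hJp : J p = 0 := by
    rw [J_apply, ← hqint]
    exact (integral_congr_ae hae).symm
  have hsq : ∫ x in Tref, (q x) ^ 2 = J (p * p) := by
    rw [J_apply]
    refine integral_congr_ae ?_
    filter_upwards [hae] with x hx
    rw [hx, pw_mul, sq]
  obtain ⟨c, hc⟩ := hspan p hpd hJp
  have hP := Adm.sum hF c
  have hQ := Adm.sum hG c
  have hpdiv : ∀ i, p i = MvPolynomial.pderiv 0 ((∑ j, c j • F j) i)
      + MvPolynomial.pderiv 1 ((∑ j, c j • G j) i) := by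
    intro i
    have e0 := congrFun (pderiv_sum 0 F c) i
    have e1 := congrFun (pderiv_sum 1 G c) i
    beta_reduce at e0 e1
    rw [e0, e1, hc]
    simp only [Finset.sum_apply, Pi.smul_apply, ← Finset.sum_add_distrib, ← smul_add]
    exact Finset.sum_congr rfl fun j _ => by rw [hdiv j i]
  have henc := hen c
  generalize (∑ j, c j • F j) = P at hP hpdiv henc
  generalize (∑ j, c j • G j) = Q at hQ hpdiv henc
  refine ⟨fun x => (pw P x, pw Q x), ?_, ?_, ?_, ?_, ?_⟩
  · exact ((continuousOn_pw hP.compat).prodMk (continuousOn_pw hQ.compat)).mono closure_Tref_sub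
  · intro x hx
    rw [isOpen_Tref.frontier_eq] at hx
    have hT := closure_Tref_sub hx.1
    simp only
    rw [pw_frontier hP.compat hP.bd hT hx.2, pw_frontier hQ.compat hQ.bd hT hx.2]
    rfl
  · intro i
    refine ⟨P i, Q i, hP.deg i, hQ.deg i, fun x hx => ?_⟩
    have hK := closure_ctK_sub_Kc i hx
    simp only
    rw [pw_Kc hP.compat i x hK, pw_Kc hQ.compat i x hK]
    rfl
  · intro i x hx
    have hd : HasFDerivAt (fun x => (pw P x, pw Q x)) _ x :=
      ((hasFDerivAt_ev (P i) x).prodMk (hasFDerivAt_ev (Q i) x)).congr_of_eventuallyEq (by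
        filter_upwards [isOpen_interior.mem_nhds hx] with y hy
        have hK := ctK_sub_Kc i hy
        rw [pw_Kc hP.compat i y hK, pw_Kc hQ.compat i y hK])
    rw [pdiv, hd.fderiv, hpq i x hx, hpdiv i]
    simp [ev]
  · refine henc.trans ?_
    rw [Real.sq_sqrt (by positivity), hsq]
    have h1 := hco c
    rw [← hc] at h1
    have h2 : ‖c‖ ^ 2 ≤ J (p * p) / m := by rw [le_div_iff₀ hm]; linarith
    have h3 := J_sq_nonneg p
    calc M * ‖c‖ ^ 2 ≤ M * (J (p * p) / m) := mul_le_mul_of_nonneg_left h2 hM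
      _ = M / m * J (p * p) := by ring
      _ ≤ (M / m + 1) * J (p * p) := by linarith
end
end

section
/- Fix an integer k ≥ 2 and constants C_F, c₁, c₂ > 0. There exists C > 0, depending only on k, C_F, c₁, c₂, such that for every h ∈ (0,1], every map F : ℝ² → ℝ² with polynomial components of total degree ≤ k satisfying the isoparametric bounds of order k (with constants C_F, c₁, c₂ and parameter h), every v̂ : ℝ² → ℝ² with polynomial components of total degree ≤ k, and every i ∈ {1,2,3}, one has |A v̂|_{H^{k+1}(K̂ᵢ)} ≤ C h^k ‖v‖_{H^k(F(K̂ᵢ))}, where A(x̂) := DF(x̂)/det DF(x̂), (A v̂)(x̂) := A(x̂)v̂(x̂), and v is the Piola transform of v̂ under F. -/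
open Set MeasureTheory Function

noncomputable section

section Helpers
open scoped ContDiff

/-! ### Polynomials have vanishing high derivatives -/

lemma zd_mul {f g : ℝ × ℝ → ℝ} {a b : ℕ} (hf : ContDiff ℝ ∞ f) (hg : ContDiff ℝ ∞ g)
    (hfa : ∀ m, a < m → ∀ x, iteratedFDeriv ℝ m f x = 0)
    (hgb : ∀ m, b < m → ∀ x, iteratedFDeriv ℝ m g x = 0) :
    ∀ m, a + b < m → ∀ x, iteratedFDeriv ℝ m (fun y => f y * g y) x = 0 := by
  intro m hm x
  have h := norm_iteratedFDeriv_mul_le hf hg x (n := m) (by exact_mod_cast le_top)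
  have h0 : ∑ i ∈ Finset.range (m + 1), (m.choose i : ℝ) * ‖iteratedFDeriv ℝ i f x‖ *
      ‖iteratedFDeriv ℝ (m - i) g x‖ = 0 := by
    apply Finset.sum_eq_zero
    intro i hi
    by_cases hia : a < i
    · simp [hfa i hia x]
    · simp [hgb (m - i) (by omega) x]
  rw [h0] at h
  exact norm_le_zero_iff.1 h

lemma zd_const (c : ℝ) : ∀ m, 0 < m → ∀ x, iteratedFDeriv ℝ m (fun _ : ℝ × ℝ => c) x = 0 := by
  intro m hm x
  rw [iteratedFDeriv_const_of_ne (by omega)]; rfl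

lemma zd_lin (L : (ℝ × ℝ) →L[ℝ] ℝ) : ∀ m, 1 < m → ∀ x,
    iteratedFDeriv ℝ m (fun y => L y) x = 0 := by
  intro m hm x
  obtain ⟨n, rfl⟩ : ∃ n, m = n + 1 := ⟨m - 1, by omega⟩
  rw [← norm_eq_zero, ← norm_iteratedFDeriv_fderiv]
  have : fderiv ℝ (fun y => L y) = fun _ => L := by
    ext1 y; exact L.fderiv
  rw [this, iteratedFDeriv_const_of_ne (by omega)]; simp

lemma zd_pow {f : ℝ × ℝ → ℝ} (hf : ContDiff ℝ ∞ f)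
    (hf1 : ∀ m, 1 < m → ∀ x, iteratedFDeriv ℝ m f x = 0) (n : ℕ) :
    ∀ m, n < m → ∀ x, iteratedFDeriv ℝ m (fun y => f y ^ n) x = 0 := by
  induction n with
  | zero => simpa using zd_const 1
  | succ n ih =>
    simp only [pow_succ]
    exact zd_mul (hf.pow n) hf ih hf1

lemma poly_cd (P : MvPolynomial (Fin 2) ℝ) :
    ContDiff ℝ ∞ (fun x : ℝ × ℝ => MvPolynomial.eval ![x.1, x.2] P) := by
  simp only [MvPolynomial.eval_eq', Fin.prod_univ_two, Matrix.cons_val_zero, Matrix.cons_val_one]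
  fun_prop

lemma poly_zd {k : ℕ} (P : MvPolynomial (Fin 2) ℝ) (hP : P.totalDegree ≤ k) :
    ∀ m, k < m → ∀ x, iteratedFDeriv ℝ m
      (fun x : ℝ × ℝ => MvPolynomial.eval ![x.1, x.2] P) x = 0 := by
  intro m hm x
  simp only [MvPolynomial.eval_eq', Fin.prod_univ_two, Matrix.cons_val_zero, Matrix.cons_val_one]
  have hfst : ContDiff ℝ ∞ (fun y : ℝ × ℝ => y.1) := contDiff_fst
  have hsnd : ContDiff ℝ ∞ (fun y : ℝ × ℝ => y.2) := contDiff_snd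
  rw [iteratedFDeriv_fun_sum_apply]
  · apply Finset.sum_eq_zero
    intro d hd
    have hdeg := (MvPolynomial.le_totalDegree hd).trans hP
    have hs : (d.sum fun _ e => e) = d 0 + d 1 := by
      rw [Finsupp.sum_fintype _ _ (by simp)]; simp
    have h1 := zd_pow hfst (zd_lin (ContinuousLinearMap.fst ℝ ℝ ℝ)) (d 0)
    have h2 := zd_pow hsnd (zd_lin (ContinuousLinearMap.snd ℝ ℝ ℝ)) (d 1)
    have h3 := zd_mul (hfst.pow _) (hsnd.pow _) h1 h2
    exact zd_mul (a := 0) contDiff_const ((hfst.pow _).mul (hsnd.pow _)) (zd_const _) h3 m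
      (by omega) x
  · intro d hd
    apply ContDiff.contDiffAt
    fun_prop

lemma polyMap_cd {k : ℕ} {F : ℝ × ℝ → ℝ × ℝ} (hF : IsPolyMap k F) : ContDiff ℝ ∞ F := by
  obtain ⟨P, Q, -, -, h⟩ := hF
  rw [funext h]
  exact (poly_cd P).prodMk (poly_cd Q)

lemma polyMap_zd {k : ℕ} {F : ℝ × ℝ → ℝ × ℝ} (hF : IsPolyMap k F) :
    ∀ m, k < m → ∀ x, iteratedFDeriv ℝ m F x = 0 := by
  obtain ⟨P, Q, hP, hQ, h⟩ := hF
  intro m hm x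
  rw [funext h, iteratedFDeriv_prodMk (n := ∞) (poly_cd P).contDiffAt (poly_cd Q).contDiffAt
    (by exact_mod_cast le_top)]
  rw [← norm_eq_zero, ContinuousMultilinearMap.opNorm_prod, poly_zd P hP m hm, poly_zd Q hQ m hm]
  simp

/-! ### The reference triangle -/

lemma isOpen_Tref : IsOpen Tref := by
  unfold Tref
  exact (isOpen_lt continuous_const continuous_fst).inter
    ((isOpen_lt continuous_const continuous_snd).inter
      (isOpen_lt (continuous_fst.add continuous_snd) continuous_const))

lemma convex_Tref : Convex ℝ Tref := by
  rintro ⟨a, b⟩ ⟨ha, hb, hab⟩ ⟨c, d⟩ ⟨hc, hd, hcd⟩ s t hs ht hst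
  simp only at *
  refine ⟨?_, ?_, ?_⟩ <;> simp only [Prod.smul_mk, Prod.mk_add_mk, smul_eq_mul]
  · rcases hs.eq_or_lt with h | h
    · subst h; simp at hst; subst hst; simpa
    · have := mul_pos h ha; have := mul_nonneg ht hc.le; linarith
  · rcases hs.eq_or_lt with h | h
    · subst h; simp at hst; subst hst; simpa
    · have := mul_pos h hb; have := mul_nonneg ht hd.le; linarith
  · rcases hs.eq_or_lt with h | h
    · subst h; simp at hst; subst hst; simpa
    · have := mul_pos h (sub_pos.2 hab); have := mul_nonneg ht (sub_pos.2 hcd).le; nlinarith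

lemma mem_closure_Tref {x : ℝ × ℝ} (h1 : 0 ≤ x.1) (h2 : 0 ≤ x.2) (h3 : x.1 + x.2 ≤ 1) :
    x ∈ closure Tref := by
  have hb : ((1 : ℝ) / 3, (1 : ℝ) / 3) ∈ Tref := by
    refine ⟨?_, ?_, ?_⟩ <;> norm_num
  have ht : Filter.Tendsto (fun t : ℝ => (1 - t) • x + t • ((1 : ℝ) / 3, (1 : ℝ) / 3))
      (nhdsWithin 0 (Ioi 0)) (nhds x) := by
    have : Continuous (fun t : ℝ => (1 - t) • x + t • ((1 : ℝ) / 3, (1 : ℝ) / 3)) := by fun_prop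
    have h := this.tendsto 0
    simp only [sub_zero, one_smul, zero_smul, add_zero] at h
    exact h.mono_left nhdsWithin_le_nhds
  apply mem_closure_of_tendsto ht
  have hmem : Ioo (0 : ℝ) 1 ∈ nhdsWithin (0 : ℝ) (Ioi 0) := Ioo_mem_nhdsGT one_pos
  filter_upwards [hmem] with t ht
  obtain ⟨h0, h1'⟩ := ht
  refine ⟨?_, ?_, ?_⟩ <;> simp only [Prod.fst_add, Prod.snd_add, Prod.smul_fst, Prod.smul_snd,
    smul_eq_mul]
  · have := mul_nonneg (sub_pos.2 h1').le h1; linarith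
  · have := mul_nonneg (sub_pos.2 h1').le h2; linarith
  · have := mul_nonneg (sub_pos.2 h1').le (sub_nonneg.2 h3); linarith

lemma ctK_subset (i : Fin 3) : ctK i ⊆ Tref := by
  have hv : ∀ i, vtx i ∈ closure Tref := by
    intro i
    fin_cases i <;> apply mem_closure_Tref <;> simp [vtx]
  have hc : convexHull ℝ {vtx i, vtx (i + 1), ((1 : ℝ) / 3, (1 : ℝ) / 3)} ⊆ closure Tref := by
    apply convexHull_min _ convex_Tref.closure
    rintro x (rfl | rfl | rfl)
    · exact hv _
    · exact hv _
    · apply mem_closure_Tref <;> norm_num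
  have hi : interior (closure Tref) = Tref := by
    rw [convex_Tref.interior_closure_eq_interior_of_nonempty_interior, isOpen_Tref.interior_eq]
    rw [isOpen_Tref.interior_eq]
    exact ⟨((1 : ℝ) / 3, (1 : ℝ) / 3), by refine ⟨?_, ?_, ?_⟩ <;> norm_num⟩
  rw [← hi]
  exact interior_mono hc

lemma isCompact_closure_Tref : IsCompact (closure Tref) := by
  have hb : Bornology.IsBounded Tref := by
    apply (Metric.isBounded_Icc ((0, 0) : ℝ × ℝ) (1, 1)).subset
    rintro ⟨a, b⟩ ⟨h1, h2, h3⟩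
    simp only at h1 h2 h3
    constructor <;> constructor <;> simp only <;> linarith
  exact hb.isCompact_closure

lemma isOpen_ctK (i : Fin 3) : IsOpen (ctK i) := isOpen_interior

lemma volume_ctK (i : Fin 3) : volume (ctK i) ≠ ⊤ := by
  have h := isCompact_closure_Tref.measure_lt_top (μ := (volume : Measure (ℝ × ℝ)))
  exact ((measure_mono ((ctK_subset i).trans subset_closure)).trans_lt h).ne

/-! ### Scaled derivative bounds -/

/-- All derivatives of `f` of order `m ≤ N` at `x` are bounded by `C h^(a+m)`. -/
structure Bd (N : ℕ) (h C : ℝ) (a : ℤ) (x : ℝ × ℝ) (f : ℝ × ℝ → ℝ) : Prop where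
  cd : ContDiffOn ℝ ∞ f Tref
  bd : ∀ m : ℕ, m ≤ N → ‖iteratedFDerivWithin ℝ m f Tref x‖ ≤ C * h ^ (a + m)

lemma ud : UniqueDiffOn ℝ Tref := isOpen_Tref.uniqueDiffOn

variable {N : ℕ} {h C C' : ℝ} {a b : ℤ} {x : ℝ × ℝ} {f g : ℝ × ℝ → ℝ}

lemma Bd.nonneg (hh : 0 < h) (hf : Bd N h C a x f) : 0 ≤ C := by
  have h1 := (norm_nonneg _).trans (hf.bd 0 (Nat.zero_le _))
  exact nonneg_of_mul_nonneg_left h1 (by positivity)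

lemma Bd.mono (hh : 0 < h) (hf : Bd N h C a x f) (hC : C ≤ C') : Bd N h C' a x f :=
  ⟨hf.cd, fun m hm => (hf.bd m hm).trans (by gcongr)⟩

lemma Bd.mul (hh : 0 < h) (hx : x ∈ Tref) (hf : Bd N h C a x f) (hg : Bd N h C' b x g) :
    Bd N h (2 ^ N * C * C') (a + b) x (fun y => f y * g y) := by
  have hC := hf.nonneg hh
  have hC' := hg.nonneg hh
  refine ⟨hf.cd.mul hg.cd, fun m hm => ?_⟩
  refine (norm_iteratedFDerivWithin_mul_le hf.cd hg.cd ud hx (n := m)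
    (by exact_mod_cast le_top)).trans ?_
  have hterm : ∀ i ∈ Finset.range (m + 1), (m.choose i : ℝ) *
      ‖iteratedFDerivWithin ℝ i f Tref x‖ * ‖iteratedFDerivWithin ℝ (m - i) g Tref x‖ ≤
      (m.choose i : ℝ) * (C * C' * h ^ (a + b + m)) := by
    intro i hi
    have hi' : i ≤ m := by simpa [Nat.lt_succ_iff] using hi
    rw [mul_assoc]
    refine mul_le_mul_of_nonneg_left ?_ (by positivity)
    calc _ ≤ (C * h ^ (a + i)) * (C' * h ^ (b + ((m - i : ℕ) : ℤ))) := by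
          gcongr
          · exact hf.bd i (by omega)
          · exact hg.bd (m - i) (by omega)
      _ = C * C' * (h ^ (a + i) * h ^ (b + ((m - i : ℕ) : ℤ))) := by ring
      _ = _ := by
          rw [← zpow_add₀ hh.ne']
          congr 2
          push_cast [hi']; ring
  refine (Finset.sum_le_sum hterm).trans ?_
  rw [← Finset.sum_mul]
  have : (∑ i ∈ Finset.range (m + 1), (m.choose i : ℝ)) = 2 ^ m := by
    exact_mod_cast Nat.sum_range_choose m
  rw [this]
  have h2 : (2 : ℝ) ^ m ≤ 2 ^ N := pow_le_pow_right₀ (by norm_num) hm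
  calc _ ≤ (2 : ℝ) ^ N * (C * C' * h ^ (a + b + m)) := by gcongr
    _ = _ := by ring

lemma Bd.add (hx : x ∈ Tref) (hf : Bd N h C a x f) (hg : Bd N h C' a x g) :
    Bd N h (C + C') a x (fun y => f y + g y) := by
  refine ⟨hf.cd.add hg.cd, fun m hm => ?_⟩
  have hm' : (m : WithTop ℕ∞) ≤ ∞ := by exact_mod_cast le_top
  have := iteratedFDerivWithin_add_apply (i := m) ((hf.cd x hx).of_le hm')
    ((hg.cd x hx).of_le hm') ud hx
  change ‖iteratedFDerivWithin ℝ m (f + g) Tref x‖ ≤ _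
  rw [this, add_mul]
  exact (norm_add_le _ _).trans (add_le_add (hf.bd m hm) (hg.bd m hm))

lemma Bd.sub (hx : x ∈ Tref) (hf : Bd N h C a x f) (hg : Bd N h C' a x g) :
    Bd N h (C + C') a x (fun y => f y - g y) := by
  refine ⟨hf.cd.sub hg.cd, fun m hm => ?_⟩
  have hm' : (m : WithTop ℕ∞) ≤ ∞ := by exact_mod_cast le_top
  have := iteratedFDerivWithin_sub_apply (i := m) ((hf.cd x hx).of_le hm')
    ((hg.cd x hx).of_le hm') ud hx
  change ‖iteratedFDerivWithin ℝ m (f - g) Tref x‖ ≤ _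
  rw [this, add_mul]
  exact (norm_sub_le _ _).trans (add_le_add (hf.bd m hm) (hg.bd m hm))

lemma Bd.const_mul (hx : x ∈ Tref) (hh : 0 < h) (hf : Bd N h C a x f) :
    Bd N h C (a + b) x (fun y => h ^ b * f y) := by
  refine ⟨contDiffOn_const.mul hf.cd, fun m hm => ?_⟩
  have hm' : (m : WithTop ℕ∞) ≤ ∞ := by exact_mod_cast le_top
  change ‖iteratedFDerivWithin ℝ m (h ^ b • f) Tref x‖ ≤ _
  rw [iteratedFDerivWithin_const_smul_apply ((hf.cd x hx).of_le hm') ud hx, norm_smul,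
    Real.norm_of_nonneg (by positivity)]
  calc _ ≤ h ^ b * (C * h ^ (a + m)) := by
        gcongr; exact hf.bd m hm
    _ = C * (h ^ b * h ^ (a + m)) := by ring
    _ = _ := by rw [← zpow_add₀ hh.ne']; congr 2; ring

lemma inv_bd (N : ℕ) {c₁ c₂ : ℝ} (hc₁ : 0 < c₁) : ∃ K : ℝ, 0 ≤ K ∧ ∀ i ≤ N, ∀ t ∈ Icc c₁ c₂,
    ‖iteratedFDerivWithin ℝ i (fun t : ℝ => t⁻¹) (Ioi 0) t‖ ≤ K := by
  have hcd : ContDiffOn ℝ ∞ (fun t : ℝ => t⁻¹) (Ioi 0) :=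
    fun t ht => (contDiffAt_inv ℝ (ne_of_gt ht)).contDiffWithinAt
  have h1 : ∀ i : ℕ, ∃ K : ℝ, ∀ t ∈ Icc c₁ c₂,
      ‖iteratedFDerivWithin ℝ i (fun t : ℝ => t⁻¹) (Ioi 0) t‖ ≤ K := by
    intro i
    apply isCompact_Icc.exists_bound_of_continuousOn
    apply (hcd.continuousOn_iteratedFDerivWithin (by exact_mod_cast le_top)
      isOpen_Ioi.uniqueDiffOn).mono
    intro t ht
    exact lt_of_lt_of_le hc₁ ht.1
  choose K hK using h1
  refine ⟨∑ i ∈ Finset.range (N + 1), |K i|, Finset.sum_nonneg fun _ _ => abs_nonneg _, ?_⟩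
  intro i hi t ht
  refine (hK i t ht).trans ((le_abs_self _).trans ?_)
  exact Finset.single_le_sum (f := fun i => |K i|) (fun _ _ => abs_nonneg _)
    (Finset.mem_range.2 (by omega))

/-- Bound of the derivatives of a composition. -/
lemma comp_bd {E G : Type*} [NormedAddCommGroup E] [NormedSpace ℝ E] [NormedAddCommGroup G]
    [NormedSpace ℝ G] {g : E → G} {f : ℝ × ℝ → E} {t : Set E} (ht : IsOpen t)
    (hg : ContDiffOn ℝ ∞ g t) (hf : ContDiffOn ℝ ∞ f Tref) (hmaps : MapsTo f Tref t)
    (hx : x ∈ Tref) (hh : 0 < h) {S M : ℝ} {N : ℕ} (hM : 0 ≤ M)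
    (hS : ∀ i ≤ N, ‖iteratedFDerivWithin ℝ i g t (f x)‖ ≤ S)
    (hD : ∀ i, i ≤ N → ‖iteratedFDerivWithin ℝ i f Tref x‖ ≤ M * h ^ i) :
    ∀ m ≤ N, ‖iteratedFDerivWithin ℝ m (g ∘ f) Tref x‖ ≤ (N.factorial * (M + 1) ^ N) * S * h ^ m := by
  intro m hm
  have hS0 : 0 ≤ S := (norm_nonneg _).trans (hS 0 (Nat.zero_le _))
  have := norm_iteratedFDerivWithin_comp_le hg hf (n := m) (by exact_mod_cast le_top)
    ht.uniqueDiffOn ud hmaps hx (C := S) (D := (M + 1) * h) (fun i hi => hS i (hi.trans hm))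
    (fun i hi hi' => (hD i (hi'.trans hm)).trans ?_)
  · refine this.trans ?_
    have h1 : (m.factorial : ℝ) ≤ N.factorial := by exact_mod_cast Nat.factorial_le hm
    have h2 : (M + 1) ^ m ≤ (M + 1) ^ N := pow_le_pow_right₀ (by linarith) hm
    calc _ = ((m.factorial : ℝ) * (M + 1) ^ m) * S * h ^ m := by rw [mul_pow]; ring
      _ ≤ _ := by gcongr
  · rw [mul_pow]
    gcongr
    calc M ≤ M + 1 := by linarith
      _ ≤ (M + 1) ^ i := le_self_pow₀ (by linarith) (by omega)

lemma Bd.inv (N : ℕ) {c₁ c₂ M : ℝ} (hc₁ : 0 < c₁) : ∃ K : ℝ, ∀ h : ℝ, 0 < h →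
    ∀ J : ℝ × ℝ → ℝ, (∀ y ∈ Tref, c₁ * h ^ 2 ≤ J y ∧ J y ≤ c₂ * h ^ 2) →
    ∀ x ∈ Tref, Bd N h M 2 x J → Bd N h K (-2) x (fun y => (J y)⁻¹) := by
  obtain ⟨K, hK, hKb⟩ := inv_bd N (c₂ := c₂) hc₁
  refine ⟨(N.factorial * (M + 1) ^ N) * K, fun h hh J hJ x hx hB => ?_⟩
  have hM := hB.nonneg hh
  have hB' : Bd N h M 0 x (fun y => h ^ (-2 : ℤ) * J y) := by
    simpa using hB.const_mul (b := -2) hx hh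
  have hr : ∀ y ∈ Tref, h ^ (-2 : ℤ) * J y ∈ Icc c₁ c₂ := by
    intro y hy
    have h2 : h ^ (-2 : ℤ) = (h ^ 2)⁻¹ := by
      rw [zpow_neg]; norm_cast
    have hh2 : 0 < h ^ 2 := by positivity
    rw [h2, inv_mul_eq_div]
    exact ⟨(le_div_iff₀ hh2).2 (hJ y hy).1, (div_le_iff₀ hh2).2 (hJ y hy).2⟩
  have hmaps : MapsTo (fun y => h ^ (-2 : ℤ) * J y) Tref (Ioi 0) :=
    fun y hy => lt_of_lt_of_le hc₁ (hr y hy).1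
  have hcd : ContDiffOn ℝ ∞ (fun t : ℝ => t⁻¹) (Ioi 0) :=
    fun t ht => (contDiffAt_inv ℝ (ne_of_gt ht)).contDiffWithinAt
  have hb := comp_bd isOpen_Ioi hcd hB'.cd hmaps hx hh hM (N := N) (S := K)
    (fun i hi => hKb i hi _ (hr x hx))
    (fun i hi => by simpa using hB'.bd i hi)
  have hB2 : Bd N h ((N.factorial * (M + 1) ^ N) * K) 0 x
      ((fun t : ℝ => t⁻¹) ∘ (fun y => h ^ (-2 : ℤ) * J y)) :=
    ⟨hcd.comp hB'.cd hmaps, fun m hm => by simpa using hb m hm⟩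
  have hB3 := hB2.const_mul (b := -2) hx hh
  have he : (fun y => h ^ (-2 : ℤ) * ((fun t : ℝ => t⁻¹) ∘ (fun y => h ^ (-2 : ℤ) * J y)) y) =
      fun y => (J y)⁻¹ := by
    ext y
    simp only [comp_apply, mul_inv]
    rw [← mul_assoc, mul_inv_cancel₀ (by positivity), one_mul]
  rw [he] at hB3
  simpa using hB3

/-! ### The geometry of the isoparametric map -/

def eA (F : ℝ × ℝ → ℝ × ℝ) (x : ℝ × ℝ) : ℝ := (fderiv ℝ F x (1, 0)).1
def eB (F : ℝ × ℝ → ℝ × ℝ) (x : ℝ × ℝ) : ℝ := (fderiv ℝ F x (0, 1)).1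
def eC (F : ℝ × ℝ → ℝ × ℝ) (x : ℝ × ℝ) : ℝ := (fderiv ℝ F x (1, 0)).2
def eD (F : ℝ × ℝ → ℝ × ℝ) (x : ℝ × ℝ) : ℝ := (fderiv ℝ F x (0, 1)).2

lemma jacDet_eq (F : ℝ × ℝ → ℝ × ℝ) (x : ℝ × ℝ) :
    jacDet F x = eA F x * eD F x - eB F x * eC F x := by
  unfold jacDet eA eB eC eD
  rw [← LinearMap.det_toMatrix (Module.Basis.finTwoProd ℝ), Matrix.det_fin_two]
  simp [LinearMap.toMatrix_apply]

lemma fderiv_decomp (F : ℝ × ℝ → ℝ × ℝ) (x z : ℝ × ℝ) :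
    fderiv ℝ F x z = (eA F x * z.1 + eB F x * z.2, eC F x * z.1 + eD F x * z.2) := by
  have hz : z = z.1 • ((1 : ℝ), (0 : ℝ)) + z.2 • ((0 : ℝ), (1 : ℝ)) := by
    ext <;> simp
  conv_lhs => rw [hz]
  rw [map_add, map_smul, map_smul]
  unfold eA eB eC eD
  ext <;> simp <;> ring

lemma Amap_apply (F : ℝ × ℝ → ℝ × ℝ) (x z : ℝ × ℝ) :
    Amap F x z = ((jacDet F x)⁻¹ * (eA F x * z.1 + eB F x * z.2),
      (jacDet F x)⁻¹ * (eC F x * z.1 + eD F x * z.2)) := by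
  unfold Amap
  rw [smul_apply, fderiv_decomp]
  rfl

lemma entry_bd {k : ℕ} {CF c₁ c₂ h : ℝ} {F : ℝ × ℝ → ℝ × ℝ} (hh : 0 < h) (hCF : 0 < CF)
    (hF : IsPolyMap k F) (hI : IsoparamBounds k CF c₁ c₂ h F) (L : (ℝ × ℝ) →L[ℝ] ℝ)
    (hL : ‖L‖ ≤ 1) (e : ℝ × ℝ) (he : ‖e‖ ≤ 1) {x : ℝ × ℝ} (hx : x ∈ Tref) :
    Bd (k + 1) h CF 1 x (fun y => L (fderiv ℝ F y e)) := by
  have hcd := polyMap_cd hF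
  have hcd1 : ContDiff ℝ ∞ (fderiv ℝ F) := hcd.fderiv_right (by simp)
  have hcd2 : ContDiff ℝ ∞ (fun y => fderiv ℝ F y e) := hcd1.clm_apply contDiff_const
  refine ⟨(L.contDiff.comp hcd2).contDiffOn, fun m hm => ?_⟩
  have hm' : (m : WithTop ℕ∞) ≤ ∞ := by exact_mod_cast le_top
  rw [iteratedFDerivWithin_of_isOpen m isOpen_Tref hx]
  have h1 := L.norm_iteratedFDeriv_comp_left (f := fun y => fderiv ℝ F y e) (x := x)
    hcd2.contDiffAt hm'
  have h2 := norm_iteratedFDeriv_clm_apply_const (f := fderiv ℝ F) (c := e) (x := x)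
    hcd1.contDiffAt hm'
  rw [norm_iteratedFDeriv_fderiv] at h2
  have h3 : ‖iteratedFDeriv ℝ (m + 1) F x‖ ≤ CF * h ^ (m + 1) := by
    by_cases hmk : m + 1 ≤ k
    · exact hI.2.1 _ hmk x hx
    · rw [polyMap_zd hF _ (by omega)]
      simp only [norm_zero]; positivity
  have h4 : h ^ ((1 : ℤ) + m) = h ^ (m + 1) := by
    rw [add_comm]; norm_cast
  rw [h4]
  calc _ ≤ ‖L‖ * (‖e‖ * ‖iteratedFDeriv ℝ (m + 1) F x‖) := h1.trans (by gcongr)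
    _ ≤ 1 * (1 * (CF * h ^ (m + 1))) := by gcongr
    _ = _ := by ring

/-- The bounds of the entries of `DF` and of `1/det DF`. -/
structure Geo (k : ℕ) (M h : ℝ) (F : ℝ × ℝ → ℝ × ℝ) (x : ℝ × ℝ) : Prop where
  a : Bd (k + 1) h M 1 x (eA F)
  b : Bd (k + 1) h M 1 x (eB F)
  c : Bd (k + 1) h M 1 x (eC F)
  d : Bd (k + 1) h M 1 x (eD F)
  j : Bd (k + 1) h M (-2) x (fun y => (jacDet F y)⁻¹)

lemma geom (k : ℕ) {CF c₁ c₂ : ℝ} (hCF : 0 < CF) (hc₁ : 0 < c₁) : ∃ M : ℝ, 0 < M ∧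
    ∀ h : ℝ, 0 < h → ∀ F : ℝ × ℝ → ℝ × ℝ, IsPolyMap k F → IsoparamBounds k CF c₁ c₂ h F →
    ∀ x ∈ Tref, Geo k M h F x := by
  obtain ⟨K, hK⟩ := Bd.inv (k + 1) (c₁ := c₁) (c₂ := c₂)
    (M := 2 ^ (k + 1) * CF * CF + 2 ^ (k + 1) * CF * CF) hc₁
  refine ⟨max CF K, lt_max_of_lt_left hCF, fun h hh F hF hI x hx => ?_⟩
  have n1 : ‖((1 : ℝ), (0 : ℝ))‖ ≤ 1 := by simp [Prod.norm_def]
  have n2 : ‖((0 : ℝ), (1 : ℝ))‖ ≤ 1 := by simp [Prod.norm_def]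
  have l1 := ContinuousLinearMap.norm_fst_le ℝ ℝ ℝ
  have l2 := ContinuousLinearMap.norm_snd_le ℝ ℝ ℝ
  have ha : Bd (k + 1) h CF 1 x (eA F) := entry_bd hh hCF hF hI _ l1 _ n1 hx
  have hb : Bd (k + 1) h CF 1 x (eB F) := entry_bd hh hCF hF hI _ l1 _ n2 hx
  have hc : Bd (k + 1) h CF 1 x (eC F) := entry_bd hh hCF hF hI _ l2 _ n1 hx
  have hd : Bd (k + 1) h CF 1 x (eD F) := entry_bd hh hCF hF hI _ l2 _ n2 hx
  have hj := (ha.mul hh hx hd).sub hx (hb.mul hh hx hc)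
  have hj' := hK h hh (jacDet F) (fun y hy => hI.2.2.2 y (subset_closure hy)) x hx (by
    rw [funext (jacDet_eq F)]; exact hj)
  exact ⟨ha.mono hh (le_max_left _ _), hb.mono hh (le_max_left _ _), hc.mono hh (le_max_left _ _),
    hd.mono hh (le_max_left _ _), hj'.mono hh (le_max_right _ _)⟩

lemma Geo.w_bd {k : ℕ} {M h Q : ℝ} {F : ℝ × ℝ → ℝ × ℝ} {x : ℝ × ℝ} (hG : Geo k M h F x)
    (hh : 0 < h) (hx : x ∈ Tref) {vh : ℝ × ℝ → ℝ × ℝ}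
    (hp : Bd (k + 1) h Q 1 x (fun y => (vh y).1)) (hq : Bd (k + 1) h Q 1 x (fun y => (vh y).2)) :
    ContDiffOn ℝ ∞ (fun y => Amap F y (vh y)) Tref ∧ ∀ m ≤ k + 1,
      ‖iteratedFDerivWithin ℝ m (fun y => Amap F y (vh y)) Tref x‖ ≤
        2 ^ (k + 1) * M * (2 ^ (k + 1) * M * Q + 2 ^ (k + 1) * M * Q) * h ^ m := by
  have h1 := hG.j.mul hh hx ((hG.a.mul hh hx hp).add hx (hG.b.mul hh hx hq))
  have h2 := hG.j.mul hh hx ((hG.c.mul hh hx hp).add hx (hG.d.mul hh hx hq))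
  have he : (fun y => Amap F y (vh y)) = fun y =>
      ((jacDet F y)⁻¹ * (eA F y * (vh y).1 + eB F y * (vh y).2),
      (jacDet F y)⁻¹ * (eC F y * (vh y).1 + eD F y * (vh y).2)) :=
    funext fun y => Amap_apply F y (vh y)
  rw [he]
  refine ⟨h1.cd.prodMk h2.cd, fun m hm => ?_⟩
  rw [iteratedFDerivWithin_prodMk (n := ∞) (h1.cd x hx) (h2.cd x hx) ud hx
    (by exact_mod_cast le_top), ContinuousMultilinearMap.opNorm_prod]
  exact max_le (by simpa using h1.bd m hm) (by simpa using h2.bd m hm)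

lemma inv_cd {k : ℕ} {CF c₁ c₂ h : ℝ} {F : ℝ × ℝ → ℝ × ℝ} (hh : 0 < h) (hc₁ : 0 < c₁)
    (hF : IsPolyMap k F) (hI : IsoparamBounds k CF c₁ c₂ h F) :
    IsOpen (F '' Tref) ∧ ContDiffOn ℝ ∞ (invFunOn F (closure Tref)) (F '' Tref) := by
  have hcd := polyMap_cd hF
  have key : ∀ x ∈ Tref, F '' Tref ∈ nhds (F x) ∧
      ContDiffAt ℝ ∞ (invFunOn F (closure Tref)) (F x) := by
    intro x hx
    have hdet : (fderiv ℝ F x).det ≠ 0 := by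
      have := (hI.2.2.2 x (subset_closure hx)).1
      have h0 : 0 < c₁ * h ^ 2 := by positivity
      exact (h0.trans_le this).ne'
    have hd : HasFDerivAt F
        (((fderiv ℝ F x).toContinuousLinearEquivOfDetNeZero hdet : (ℝ × ℝ) ≃L[ℝ] (ℝ × ℝ)) :
          (ℝ × ℝ) →L[ℝ] (ℝ × ℝ)) x := by
      rw [ContinuousLinearMap.coe_toContinuousLinearEquivOfDetNeZero]
      exact (hcd.differentiable (by simp) x).hasFDerivAt
    have hs := (hcd.contDiffAt (x := x)).hasStrictFDerivAt' hd (by simp)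
    constructor
    · rw [← hs.map_nhds_eq_of_equiv]
      exact Filter.image_mem_map (isOpen_Tref.mem_nhds hx)
    · have hl := (hcd.contDiffAt (x := x)).to_localInverse hd (by simp)
      refine hl.congr_of_eventuallyEq ?_
      refine hs.localInverse_unique ?_
      filter_upwards [isOpen_Tref.mem_nhds hx] with y hy
      exact hI.1.leftInvOn_invFunOn (subset_closure hy)
  refine ⟨isOpen_iff_mem_nhds.2 ?_, ?_⟩
  · rintro _ ⟨x, hx, rfl⟩
    exact (key x hx).1
  · rintro _ ⟨x, hx, rfl⟩
    exact (key x hx).2.contDiffWithinAt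

lemma F_bd {k : ℕ} {CF c₁ c₂ h : ℝ} {F : ℝ × ℝ → ℝ × ℝ}
    (hI : IsoparamBounds k CF c₁ c₂ h F) {x : ℝ × ℝ} (hx : x ∈ Tref) :
    ∀ i, i ≤ k → ‖iteratedFDerivWithin ℝ i F Tref x‖ ≤ CF * h ^ i := by
  intro i hi
  rw [iteratedFDerivWithin_of_isOpen i isOpen_Tref hx]
  exact hI.2.1 i hi x hx

lemma inv_maps {k : ℕ} {CF c₁ c₂ h : ℝ} {F : ℝ × ℝ → ℝ × ℝ}
    (hI : IsoparamBounds k CF c₁ c₂ h F) {x : ℝ × ℝ} (hx : x ∈ Tref) :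
    invFunOn F (closure Tref) (F x) = x :=
  hI.1.leftInvOn_invFunOn (subset_closure hx)

/-- Boundedness of the derivatives of a polynomial map on the triangle. -/
lemma poly_bd {k : ℕ} {vh : ℝ × ℝ → ℝ × ℝ} (hv : IsPolyMap k vh) {h : ℝ} (hh : 0 < h)
    (hh1 : h ≤ 1) (N : ℕ) (L : (ℝ × ℝ) →L[ℝ] ℝ) :
    ∃ Q : ℝ, ∀ x ∈ Tref, Bd N h Q 1 x (fun y => L (vh y)) := by
  have hcd : ContDiff ℝ ∞ (fun y => L (vh y)) := L.contDiff.comp (polyMap_cd hv)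
  have h1 : ∀ i : ℕ, ∃ K : ℝ, ∀ x ∈ closure Tref,
      ‖iteratedFDeriv ℝ i (fun y => L (vh y)) x‖ ≤ K := by
    intro i
    apply isCompact_closure_Tref.exists_bound_of_continuousOn
    exact (hcd.continuous_iteratedFDeriv (by exact_mod_cast le_top)).continuousOn
  choose K hK using h1
  refine ⟨(∑ i ∈ Finset.range (N + 1), |K i|) * (h ^ (N + 1))⁻¹, fun x hx =>
    ⟨hcd.contDiffOn, fun m hm => ?_⟩⟩
  rw [iteratedFDerivWithin_of_isOpen m isOpen_Tref hx]
  have h2 : ‖iteratedFDeriv ℝ m (fun y => L (vh y)) x‖ ≤ ∑ i ∈ Finset.range (N + 1), |K i| := by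
    refine (hK m x (subset_closure hx)).trans ((le_abs_self _).trans ?_)
    exact Finset.single_le_sum (f := fun i => |K i|) (fun _ _ => abs_nonneg _)
      (Finset.mem_range.2 (by omega))
  have h4 : h ^ ((1 : ℤ) + m) = h ^ (m + 1) := by
    rw [add_comm]; norm_cast
  have h5 : h ^ (N + 1) ≤ h ^ (m + 1) := pow_le_pow_of_le_one hh.le hh1 (by omega)
  have h6 : 1 ≤ (h ^ (N + 1))⁻¹ * h ^ (m + 1) := by
    rw [inv_mul_eq_div, le_div_iff₀ (by positivity)]; simpa using h5
  rw [h4, mul_assoc]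
  exact h2.trans (le_mul_of_one_le_right (Finset.sum_nonneg fun _ _ => abs_nonneg _) h6)

/-- Smoothness and boundedness of the Piola transform. -/
lemma v_reg {k : ℕ} {CF c₁ c₂ h : ℝ} {F vh v : ℝ × ℝ → ℝ × ℝ} (hh : 0 < h) (hh1 : h ≤ 1)
    (hCF : 0 < CF) (hc₁ : 0 < c₁) (hF : IsPolyMap k F) (hI : IsoparamBounds k CF c₁ c₂ h F)
    (hvh : IsPolyMap k vh) (hv : IsPiola F vh v) :
    ContDiffOn ℝ ∞ v (F '' Tref) ∧ ∃ S : ℝ, ∀ r ≤ k, ∀ x ∈ Tref,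
      ‖iteratedFDeriv ℝ r v (F x)‖ ≤ S := by
  obtain ⟨hop, hG⟩ := inv_cd hh hc₁ hF hI
  obtain ⟨M, hM, hgeo⟩ := geom k (c₂ := c₂) hCF hc₁
  obtain ⟨Q1, hQ1⟩ := poly_bd hvh hh hh1 (k + 1) (ContinuousLinearMap.fst ℝ ℝ ℝ)
  obtain ⟨Q2, hQ2⟩ := poly_bd hvh hh hh1 (k + 1) (ContinuousLinearMap.snd ℝ ℝ ℝ)
  have hw := fun x (hx : x ∈ Tref) => (hgeo h hh F hF hI x hx).w_bd hh hx
    ((hQ1 x hx).mono hh (le_max_left Q1 Q2)) ((hQ2 x hx).mono hh (le_max_right Q1 Q2))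
  have hwcd : ContDiffOn ℝ ∞ (fun y => Amap F y (vh y)) Tref := by
    intro x hx
    exact (hw x hx).1 x hx
  have hmaps : MapsTo (invFunOn F (closure Tref)) (F '' Tref) Tref := by
    rintro _ ⟨x, hx, rfl⟩
    rw [inv_maps hI hx]; exact hx
  have heq : EqOn v ((fun y => Amap F y (vh y)) ∘ invFunOn F (closure Tref)) (F '' Tref) := by
    rintro _ ⟨x, hx, rfl⟩
    simp only [comp_apply, inv_maps hI hx]
    exact hv x (subset_closure hx)
  refine ⟨(hwcd.comp hG hmaps).congr heq, ?_⟩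
  set W := 2 ^ (k + 1) * M * (2 ^ (k + 1) * M * max Q1 Q2 + 2 ^ (k + 1) * M * max Q1 Q2) with hW
  refine ⟨k.factorial * |W| * ((CF + 1) / h) ^ k, fun r hr x hx => ?_⟩
  have hFx : F x ∈ F '' Tref := ⟨x, hx, rfl⟩
  rw [← iteratedFDerivWithin_of_isOpen r hop hFx, iteratedFDerivWithin_congr heq hFx]
  have hb := norm_iteratedFDerivWithin_comp_le hwcd hG (n := r) (by exact_mod_cast le_top)
    ud hop.uniqueDiffOn hmaps hFx (C := |W|) (D := (CF + 1) / h) ?_ ?_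
  · refine hb.trans ?_
    have h1 : (r.factorial : ℝ) ≤ k.factorial := by exact_mod_cast Nat.factorial_le hr
    have h2 : ((CF + 1) / h) ^ r ≤ ((CF + 1) / h) ^ k := by
      refine pow_le_pow_right₀ ?_ hr
      rw [le_div_iff₀ hh]; linarith
    gcongr
  · intro i hi
    rw [inv_maps hI hx]
    refine ((hw x hx).2 i (by omega)).trans ?_
    have h1 : h ^ i ≤ 1 := pow_le_one₀ hh.le hh1
    calc W * h ^ i ≤ |W| * h ^ i := by gcongr; exact le_abs_self _
      _ ≤ |W| * 1 := by gcongr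
      _ = _ := mul_one _
  · intro i hi hi'
    rw [iteratedFDerivWithin_of_isOpen i hop hFx]
    refine (hI.2.2.1 i (by omega) _ hFx).trans ?_
    rw [div_pow, zpow_neg, zpow_natCast, ← div_eq_mul_inv]
    gcongr
    calc CF ≤ CF + 1 := by linarith
      _ ≤ (CF + 1) ^ i := le_self_pow₀ (by linarith) (by omega)

/-- The pointwise estimate. -/
lemma key_pointwise (k : ℕ) {CF c₁ c₂ : ℝ} (hCF : 0 < CF) (hc₁ : 0 < c₁) : ∃ C : ℝ, 0 < C ∧
    ∀ h : ℝ, 0 < h → h ≤ 1 → ∀ F : ℝ × ℝ → ℝ × ℝ, IsPolyMap k F →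
    IsoparamBounds k CF c₁ c₂ h F → ∀ vh : ℝ × ℝ → ℝ × ℝ, IsPolyMap k vh →
    ∀ v : ℝ × ℝ → ℝ × ℝ, IsPiola F vh v → ∀ x ∈ Tref,
    ‖iteratedFDeriv ℝ (k + 1) (fun y => Amap F y (vh y)) x‖ ≤
      C * h ^ (k + 1) * ∑ r ∈ Finset.range (k + 1), ‖iteratedFDeriv ℝ r v (F x)‖ := by
  obtain ⟨M, hM, hgeo⟩ := geom k (c₂ := c₂) hCF hc₁
  set R : ℝ := (k.factorial * (CF + 1) ^ k) with hR
  have hRpos : 0 < R := by positivity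
  refine ⟨2 ^ (k + 1) * M * (2 ^ (k + 1) * M * (2 ^ k * M * R + 2 ^ k * M * R) +
    2 ^ (k + 1) * M * (2 ^ k * M * R + 2 ^ k * M * R)), by positivity, ?_⟩
  intro h hh hh1 F hF hI vh hvh v hv x hx
  obtain ⟨hop, -⟩ := inv_cd hh hc₁ hF hI
  obtain ⟨hvcd, -⟩ := v_reg hh hh1 hCF hc₁ hF hI hvh hv
  set S := ∑ r ∈ Finset.range (k + 1), ‖iteratedFDeriv ℝ r v (F x)‖ with hS
  have hS0 : 0 ≤ S := Finset.sum_nonneg fun _ _ => norm_nonneg _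
  have hFcd : ContDiffOn ℝ ∞ F Tref := (polyMap_cd hF).contDiffOn
  have hmaps : MapsTo F Tref (F '' Tref) := mapsTo_image _ _
  have hcomp := comp_bd hop hvcd hFcd hmaps hx hh hCF.le (N := k) (S := S) (fun i hi => by
    rw [iteratedFDerivWithin_of_isOpen i hop (hmaps hx)]
    exact Finset.single_le_sum (f := fun r => ‖iteratedFDeriv ℝ r v (F x)‖)
      (fun _ _ => norm_nonneg _) (Finset.mem_range.2 (by omega))) (F_bd hI hx)
  have hccd : ContDiffOn ℝ ∞ (v ∘ F) Tref := hvcd.comp hFcd hmaps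
  have hL : ∀ L : (ℝ × ℝ) →L[ℝ] ℝ, ‖L‖ ≤ 1 → Bd k h (R * S) 0 x (fun y => L (v (F y))) := by
    intro L hL
    refine ⟨L.contDiff.comp_contDiffOn hccd, fun m hm => ?_⟩
    have h1 := L.norm_iteratedFDerivWithin_comp_left (hccd x hx) ud hx (n := m)
      (by exact_mod_cast le_top)
    refine h1.trans ?_
    calc _ ≤ 1 * (R * S * h ^ m) := by
          gcongr
          exact hcomp m hm
      _ = _ := by simp
  have hw1 := hL _ (ContinuousLinearMap.norm_fst_le ℝ ℝ ℝ)
  have hw2 := hL _ (ContinuousLinearMap.norm_snd_le ℝ ℝ ℝ)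
  simp only [ContinuousLinearMap.coe_fst', ContinuousLinearMap.coe_snd'] at hw1 hw2
  have hgx := hgeo h hh F hF hI x hx
  have low : ∀ {C : ℝ} {a : ℤ} {f : ℝ × ℝ → ℝ}, Bd (k + 1) h C a x f → Bd k h C a x f :=
    fun hb => ⟨hb.cd, fun m hm => hb.bd m (by omega)⟩
  have hp := ((low hgx.d).mul hh hx hw1).sub hx ((low hgx.b).mul hh hx hw2)
  have hq := ((low hgx.a).mul hh hx hw2).sub hx ((low hgx.c).mul hh hx hw1)
  have hrec : ∀ y ∈ Tref, (vh y).1 = eD F y * (v (F y)).1 - eB F y * (v (F y)).2 ∧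
      (vh y).2 = eA F y * (v (F y)).2 - eC F y * (v (F y)).1 := by
    intro y hy
    have hJ : jacDet F y ≠ 0 := by
      have := (hI.2.2.2 y (subset_closure hy)).1
      have h0 : 0 < c₁ * h ^ 2 := by positivity
      exact (h0.trans_le this).ne'
    rw [hv y (subset_closure hy), Amap_apply]
    simp only
    constructor
    · rw [← mul_right_inj' hJ]; field_simp; rw [jacDet_eq]; ring
    · rw [← mul_right_inj' hJ]; field_simp; rw [jacDet_eq]; ring
  -- extension to order `k + 1`
  have ext : ∀ (L : (ℝ × ℝ) →L[ℝ] ℝ) (g : ℝ × ℝ → ℝ) (C : ℝ), EqOn (fun y => L (vh y)) g Tref →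
      Bd k h C 1 x g → Bd (k + 1) h C 1 x (fun y => L (vh y)) := by
    intro L g C hEq hb
    have hC := hb.nonneg hh
    have hcd : ContDiff ℝ ∞ vh := polyMap_cd hvh
    refine ⟨(L.contDiff.comp hcd).contDiffOn, fun m hm => ?_⟩
    by_cases hmk : m ≤ k
    · rw [iteratedFDerivWithin_congr hEq hx]
      exact hb.bd m hmk
    · rw [iteratedFDerivWithin_of_isOpen m isOpen_Tref hx]
      have h1 := L.norm_iteratedFDeriv_comp_left (f := vh) (x := x) (n := m)
        hcd.contDiffAt (by exact_mod_cast le_top)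
      rw [polyMap_zd hvh m (by omega), norm_zero, mul_zero] at h1
      exact h1.trans (by positivity)
  have hp' := ext (ContinuousLinearMap.fst ℝ ℝ ℝ) _ _ (fun y hy => (hrec y hy).1) hp
  have hq' := ext (ContinuousLinearMap.snd ℝ ℝ ℝ) _ _ (fun y hy => (hrec y hy).2) hq
  have hfin := (hgx.w_bd hh hx hp' hq').2 (k + 1) le_rfl
  rw [iteratedFDerivWithin_of_isOpen _ isOpen_Tref hx] at hfin
  refine hfin.trans (le_of_eq ?_)
  ring

end Helpers

/-- The estimate `|A v̂|_{H^{k+1}(K̂ᵢ)} ≤ C h^k ‖v‖_{H^k(F(K̂ᵢ))}` used in the proof of the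
approximation properties of the H¹-conforming relative. -/
theorem stmt13 (k : ℕ) (hk : 2 ≤ k)
    (CF c₁ c₂ : ℝ) (hCF : 0 < CF) (hc₁ : 0 < c₁) (hc₂ : 0 < c₂) :
    ∃ C : ℝ, 0 < C ∧ ∀ h : ℝ, h ∈ Set.Ioc (0 : ℝ) 1 → ∀ F : ℝ × ℝ → ℝ × ℝ,
      IsPolyMap k F → IsoparamBounds k CF c₁ c₂ h F →
      ∀ vhat : ℝ × ℝ → ℝ × ℝ, IsPolyMap k vhat →
      ∀ v : ℝ × ℝ → ℝ × ℝ, IsPiola F vhat v →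
      ∀ i : Fin 3,
        semiLp (k + 1) 2 (fun x => Amap F x (vhat x)) (ctK i) ≤
          C * h ^ k * normWmp k 2 v (F '' ctK i) := by
  obtain ⟨C, hC, hkey⟩ := key_pointwise k (c₂ := c₂) hCF hc₁
  set A : ℝ := C * Real.sqrt ((k + 1) / c₁) with hA
  have hApos : 0 < A := by positivity
  refine ⟨A, hApos, ?_⟩
  rintro h ⟨hh, hh1⟩ F hF hI vhat hvh v hv i
  obtain ⟨hop, -⟩ := inv_cd hh hc₁ hF hI
  obtain ⟨hvcd, S, hS⟩ := v_reg hh hh1 hCF hc₁ hF hI hvh hv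
  have hFcd := polyMap_cd hF
  have hKT := ctK_subset i
  have hKm : MeasurableSet (ctK i) := (isOpen_ctK i).measurableSet
  have hJpos : ∀ x ∈ Tref, 0 < jacDet F x := fun x hx =>
    lt_of_lt_of_le (by positivity) (hI.2.2.2 x (subset_closure hx)).1
  have hcv : ∀ r : ℕ, ∫ y in F '' ctK i, ‖iteratedFDeriv ℝ r v y‖ ^ (2 : ℝ) =
      ∫ x in ctK i, |jacDet F x| * ‖iteratedFDeriv ℝ r v (F x)‖ ^ 2 := by
    intro r
    rw [integral_image_eq_integral_abs_det_fderiv_smul volume hKm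
      (f' := fun x => fderiv ℝ F x)
      (fun x _ => (hFcd.differentiable (by simp) x).hasFDerivAt.hasFDerivWithinAt)
      (hI.1.mono (hKT.trans subset_closure))]
    simp only [Real.rpow_two, smul_eq_mul]
    rfl
  have hJcont : ContinuousOn (jacDet F) (ctK i) := by
    have h1 : Continuous (fderiv ℝ F) := hFcd.continuous_fderiv (by simp)
    rw [funext (jacDet_eq F)]
    unfold eA eB eC eD
    fun_prop
  have hint : ∀ r ≤ k, IntegrableOn
      (fun x => |jacDet F x| * ‖iteratedFDeriv ℝ r v (F x)‖ ^ 2) (ctK i) := by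
    intro r hr
    have hcont : ContinuousOn
        (fun x => |jacDet F x| * ‖iteratedFDeriv ℝ r v (F x)‖ ^ 2) (ctK i) := by
      have h1 : ContinuousOn (iteratedFDeriv ℝ r v) (F '' Tref) :=
        (hvcd.continuousOn_iteratedFDerivWithin (by exact_mod_cast le_top)
          hop.uniqueDiffOn).congr (fun y hy => (iteratedFDerivWithin_of_isOpen r hop hy).symm)
      have h2 : ContinuousOn (fun x => iteratedFDeriv ℝ r v (F x)) (ctK i) :=
        h1.comp hFcd.continuous.continuousOn (fun x hx => ⟨x, hKT hx, rfl⟩)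
      exact hJcont.abs.mul (h2.norm.pow 2)
    refine ⟨hcont.aestronglyMeasurable hKm, ?_⟩
    refine HasFiniteIntegral.restrict_of_bounded (C := c₂ * h ^ 2 * S ^ 2) (volume_ctK i).lt_top ?_
    refine (ae_restrict_iff' hKm).2 (Filter.Eventually.of_forall fun x hx => ?_)
    have h1 := (hI.2.2.2 x (subset_closure (hKT hx))).2
    have h2 := hJpos x (hKT hx)
    have h3 := hS r hr x (hKT hx)
    rw [Real.norm_of_nonneg (by positivity), abs_of_pos h2]
    gcongr
  set I : ℕ → ℝ := fun r => ∫ y in F '' ctK i, ‖iteratedFDeriv ℝ r v y‖ ^ (2 : ℝ) with hIdef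
  have hI0 : ∀ r, 0 ≤ I r := fun r => integral_nonneg fun y => by positivity
  have hmain : ∫ x in ctK i,
      ‖iteratedFDeriv ℝ (k + 1) (fun x => Amap F x (vhat x)) x‖ ^ (2 : ℝ) ≤
      A ^ 2 * (h ^ k) ^ 2 * ∑ r ∈ Finset.range (k + 1), I r := by
    have hsum : A ^ 2 * (h ^ k) ^ 2 * ∑ r ∈ Finset.range (k + 1), I r =
        ∫ x in ctK i, A ^ 2 * (h ^ k) ^ 2 * ∑ r ∈ Finset.range (k + 1),
          |jacDet F x| * ‖iteratedFDeriv ℝ r v (F x)‖ ^ 2 := by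
      rw [integral_const_mul, integral_finsetSum _
        (fun r hr => hint r (by simpa [Nat.lt_succ_iff] using hr))]
      simp only [hIdef, hcv]
    rw [hsum]
    refine integral_mono_of_nonneg (Filter.Eventually.of_forall fun x => by positivity) ?_ ?_
    · exact (integrable_finsetSum _
        (fun r hr => hint r (by simpa [Nat.lt_succ_iff] using hr))).const_mul _
    · refine (ae_restrict_iff' hKm).2 (Filter.Eventually.of_forall fun x hx => ?_)
      have h1 := hkey h hh hh1 F hF hI vhat hvh v hv x (hKT hx)
      have h2 := (hI.2.2.2 x (subset_closure (hKT hx))).1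
      simp only [Real.rpow_two]
      rw [← Finset.mul_sum, abs_of_pos (hJpos x (hKT hx))]
      have hcs := sq_sum_le_card_mul_sum_sq (s := Finset.range (k + 1))
        (f := fun r => ‖iteratedFDeriv ℝ r v (F x)‖)
      simp only [Finset.card_range] at hcs
      set Q := ∑ r ∈ Finset.range (k + 1), ‖iteratedFDeriv ℝ r v (F x)‖ ^ 2 with hQ
      have hQ0 : 0 ≤ Q := Finset.sum_nonneg fun _ _ => by positivity
      have hA2 : A ^ 2 = C ^ 2 * ((k + 1) / c₁) := by
        rw [hA, mul_pow, Real.sq_sqrt (by positivity)]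
      calc _ ≤ (C * h ^ (k + 1) *
            ∑ r ∈ Finset.range (k + 1), ‖iteratedFDeriv ℝ r v (F x)‖) ^ 2 := by gcongr
        _ = (C * h ^ (k + 1)) ^ 2 *
            (∑ r ∈ Finset.range (k + 1), ‖iteratedFDeriv ℝ r v (F x)‖) ^ 2 := by ring
        _ ≤ (C * h ^ (k + 1)) ^ 2 * (((k + 1 : ℕ) : ℝ) * Q) := by gcongr
        _ = A ^ 2 * (h ^ k) ^ 2 * (c₁ * h ^ 2 * Q) := by
            rw [hA2]; push_cast; field_simp; ring
        _ ≤ _ := by gcongr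
  unfold semiLp normWmp semiLp
  rw [← Real.sqrt_eq_rpow]
  simp only [← Real.sqrt_eq_rpow]
  have hs : Real.sqrt (∑ r ∈ Finset.range (k + 1), I r) ≤
      ∑ r ∈ Finset.range (k + 1), Real.sqrt (I r) := by
    refine Real.sqrt_le_iff.2 ⟨Finset.sum_nonneg fun _ _ => Real.sqrt_nonneg _, ?_⟩
    have := Finset.sum_sq_le_sq_sum_of_nonneg (s := Finset.range (k + 1)) (f := fun r => Real.sqrt (I r))
      (fun _ _ => Real.sqrt_nonneg _)
    simpa only [Real.sq_sqrt (hI0 _)] using this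
  calc _ ≤ Real.sqrt (A ^ 2 * (h ^ k) ^ 2 * ∑ r ∈ Finset.range (k + 1), I r) :=
        Real.sqrt_le_sqrt hmain
    _ = A * h ^ k * Real.sqrt (∑ r ∈ Finset.range (k + 1), I r) := by
        rw [← mul_pow, Real.sqrt_mul (by positivity), Real.sqrt_sq (by positivity)]
    _ ≤ _ := by gcongr
end
end
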